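/- arXiv:2108.03664 — 3 statements merged into one kernel-verified Lean document; each statement's English description precedes it below -/
import Mathlib

section
/- Let b and c be integers with c > b > 1.185×10^29. Then no real number is a Trott number in both base b and base c; that is, T_b ∩ T_c = ∅. -/
open Filter Topology

/-- Number of digits of `a` in base `b`. -/
def digLen (b a : ℕ) : ℕ := (Nat.digits b a).length

/-- Value of the finite continued fraction `[0; a₁, a₂, …, aₙ]`. -/
noncomputable def cfVal : List ℕ → ℝ
  | [] => 0
  | (h :: t) => 1 / ((h : ℝ) + cfVal t)

/-- `a` witnesses that `x` is a Trott number in base `b`: the `a i` (indexed from 0)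
are positive, `x` is the value of the infinite continued fraction `[0; a 0, a 1, …]`,
and the base-`b` expansion of `x` is the concatenation of the base-`b` digit strings
of the partial quotients. -/
def IsTrottWith (b : ℕ) (x : ℝ) (a : ℕ → ℕ) : Prop :=
  (∀ i, 0 < a i) ∧
  Tendsto (fun n => cfVal ((List.range n).map a)) atTop (𝓝 x) ∧
  x = ∑' i : ℕ, (a i : ℝ) / (b : ℝ) ^ (∑ j ∈ Finset.range (i + 1), digLen b (a j))

/-- `x` is a Trott number in base `b`. -/
def IsTrott (b : ℕ) (x : ℝ) : Prop := ∃ a, IsTrottWith b x a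

/-- The set of Trott numbers in base `b`. -/
def TrottSet (b : ℕ) : Set ℝ := {x | IsTrott b x}

section ExponentialPolynomials

open Polynomial

theorem exists_mem_Icc_eq_zero_of_strictMono_zeros (m : ℕ) (f : ℕ → ℝ → ℝ)
    (hf : ∀ k x, HasDerivAt (f k) (f (k + 1) x) x) (x : Fin (m + 1) → ℝ) (hx : StrictMono x)
    {A B : ℝ} (hAB : ∀ i, x i ∈ Set.Icc A B) (h0 : ∀ i, f 0 (x i) = 0) :
    ∃ ξ ∈ Set.Icc A B, f m ξ = 0 := by
  induction m generalizing f with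
  | zero => exact ⟨x 0, hAB 0, h0 0⟩
  | succ m ih =>
    have hrolle : ∀ i : Fin (m + 1), ∃ y ∈ Set.Ioo (x i.castSucc) (x i.succ), f 1 y = 0 := fun i =>
      exists_hasDerivAt_eq_zero (hx i.castSucc_lt_succ)
        (fun t _ => (hf 0 t).continuousAt.continuousWithinAt)
        (by rw [h0, h0]) (fun t _ => hf 0 t)
    choose y hy hy0 using hrolle
    refine ih (fun k => f (k + 1)) (fun k t => hf (k + 1) t) y ?_ ?_ hy0
    · refine Fin.strictMono_iff_lt_succ.2 fun i => ?_
      have h1 := (hy i.castSucc).2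
      have h2 := (hy i.succ).1
      rw [Fin.succ_castSucc] at h1
      exact h1.trans h2
    · exact fun i => ⟨(hAB i.castSucc).1.trans (hy i).1.le, (hy i).2.le.trans (hAB i.succ).2⟩

theorem exists_eq_interpolate_add {ι : Type*} [DecidableEq ι] (s : Finset ι) (v : ι → ℝ)
    (hv : Set.InjOn v s) (f : ℕ → ℝ → ℝ) (hf : ∀ k x, HasDerivAt (f k) (f (k + 1) x) x)
    {A B x : ℝ} (hx : x ∈ Set.Icc A B) (hxv : ∀ i ∈ s, x ≠ v i)
    (hAB : ∀ i ∈ s, v i ∈ Set.Icc A B) :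
    ∃ ξ ∈ Set.Icc A B, f 0 x = (Lagrange.interpolate s v fun i => f 0 (v i)).eval x +
      f s.card ξ / (s.card.factorial : ℝ) * ∏ i ∈ s, (x - v i) := by
  set p := Lagrange.interpolate s v fun i => f 0 (v i) with hp
  set w := Lagrange.nodal s v with hw
  have hwx : w.eval x ≠ 0 := Lagrange.eval_nodal_not_at_node hxv
  set κ := (f 0 x - p.eval x) / w.eval x with hκ
  let g : ℕ → ℝ → ℝ := fun k t =>
    f k t - (derivative^[k] p).eval t - κ * (derivative^[k] w).eval t
  have hg : ∀ k t, HasDerivAt (g k) (g (k + 1) t) t := by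
    intro k t
    have h1 := (derivative^[k] p).hasDerivAt t
    have h2 := ((derivative^[k] w).hasDerivAt t).const_mul κ
    have := ((hf k t).sub h1).sub h2
    simp only [g, Function.iterate_succ_apply']
    exact this
  have hcard : (insert x (s.image v)).card = s.card + 1 := by
    rw [Finset.card_insert_of_notMem, Finset.card_image_of_injOn hv]
    simp only [Finset.mem_image, not_exists, not_and]
    exact fun i hi h => hxv i hi h.symm
  obtain ⟨ξ, hξ, h0⟩ := exists_mem_Icc_eq_zero_of_strictMono_zeros s.card g hg
    ((insert x (s.image v)).orderEmbOfFin hcard) (OrderEmbedding.strictMono _) (A := A) (B := B)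
    (fun i => by
      have := Finset.orderEmbOfFin_mem (insert x (s.image v)) hcard i
      rcases Finset.mem_insert.1 this with h | h
      · rw [h]; exact hx
      · obtain ⟨j, hj, hj'⟩ := Finset.mem_image.1 h
        rw [← hj']; exact hAB j hj)
    (fun i => by
      have := Finset.orderEmbOfFin_mem (insert x (s.image v)) hcard i
      rcases Finset.mem_insert.1 this with h | h
      · rw [h]
        simp only [g, Function.iterate_zero, id, hκ]
        field_simp
        ring
      · obtain ⟨j, hj, hj'⟩ := Finset.mem_image.1 h
        rw [← hj']
        simp only [g, Function.iterate_zero, id]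
        rw [hp, Lagrange.eval_interpolate_at_node _ hv hj, hw, Lagrange.eval_nodal_at_node hj]
        ring)
  refine ⟨ξ, hξ, ?_⟩
  have hpd : derivative^[s.card] p = 0 := by
    rcases eq_or_ne p 0 with h | h
    · rw [h, iterate_derivative_zero]
    · exact iterate_derivative_eq_zero
        ((natDegree_lt_iff_degree_lt h).2 (Lagrange.degree_interpolate_lt _ hv))
  have hwd : (derivative^[s.card] w).eval ξ = s.card.factorial := by
    have h1 : (derivative^[s.card] w).natDegree = 0 := by
      have := natDegree_iterate_derivative w s.card
      rw [hw, Lagrange.natDegree_nodal] at this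
      rw [hw]; omega
    rw [eq_C_of_natDegree_eq_zero h1, eval_C, coeff_iterate_derivative, zero_add,
      Nat.descFactorial_self]
    have : w.coeff s.card = 1 := by
      have := (Lagrange.nodal_monic (s := s) (v := v)).coeff_natDegree
      rwa [Lagrange.natDegree_nodal] at this
    rw [this]; simp
  have h1 : f s.card ξ = κ * s.card.factorial := by
    have : g s.card ξ = f s.card ξ - 0 - κ * s.card.factorial := by
      simp only [g, hpd, hwd, eval_zero]
    rw [this] at h0; linarith
  have hfac : (s.card.factorial : ℝ) ≠ 0 := by positivity
  rw [← Lagrange.eval_nodal, h1, hκ]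
  field_simp
  ring

/-- The operator `P ↦ P' + ρ P`, which is differentiation conjugated by `exp (ρ x)`. -/
noncomputable def twistDeriv (ρ : ℝ) (P : ℝ[X]) : ℝ[X] := derivative P + C ρ * P

theorem hasDerivAt_eval_mul_exp (ρ : ℝ) (P : ℝ[X]) (x : ℝ) :
    HasDerivAt (fun x => P.eval x * Real.exp (ρ * x))
      ((twistDeriv ρ P).eval x * Real.exp (ρ * x)) x := by
  have h1 := P.hasDerivAt x
  have h2 : HasDerivAt (fun x => Real.exp (ρ * x)) (Real.exp (ρ * x) * ρ) x := by
    simpa using ((hasDerivAt_id x).const_mul ρ).exp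
  refine (h1.mul h2).congr_deriv ?_
  simp only [twistDeriv, eval_add, eval_mul, eval_C]
  ring

theorem coeff_twistDeriv (ρ : ℝ) (P : ℝ[X]) (i : ℕ) :
    (twistDeriv ρ P).coeff i = P.coeff (i + 1) * (i + 1) + ρ * P.coeff i := by
  simp [twistDeriv, coeff_derivative]

theorem coeff_taylor_nonneg {P : ℝ[X]} (hP : ∀ i, 0 ≤ P.coeff i) {h : ℝ} (hh : 0 ≤ h) (i : ℕ) :
    0 ≤ (taylor h P).coeff i := by
  rw [taylor_coeff, hasseDeriv_apply, sum_def, eval_finsetSum]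
  refine Finset.sum_nonneg fun k _ => ?_
  rw [eval_monomial]
  have := hP k
  positivity

theorem coeff_add_le_coeff_taylor {P : ℝ[X]} (hP : ∀ i, 0 ≤ P.coeff i) {h : ℝ} (hh : 0 ≤ h)
    (i : ℕ) : P.coeff i + P.coeff (i + 1) * (i + 1) * h ≤ (taylor h P).coeff i := by
  rw [taylor_coeff, hasseDeriv_apply, sum_over_range' _ (by simp) (P.natDegree + i + 2) (by omega),
    eval_finsetSum]
  have hsub : ({i, i + 1} : Finset ℕ) ⊆ Finset.range (P.natDegree + i + 2) := by
    intro k hk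
    simp only [Finset.mem_insert, Finset.mem_singleton] at hk
    simp only [Finset.mem_range]; omega
  refine le_trans (le_of_eq ?_) (Finset.sum_le_sum_of_subset_of_nonneg hsub fun k _ _ => ?_)
  · rw [Finset.sum_pair (by omega)]
    simp [eval_monomial, mul_comm]
  · rw [eval_monomial]
    have := hP k
    positivity

theorem coeff_iterate_twistDeriv_le {P : ℝ[X]} (hP : ∀ i, 0 ≤ P.coeff i) {ρ σ : ℝ} (hρ : 0 ≤ ρ)
    (hρσ : ρ ≤ σ) (hσ : 0 < σ) (N : ℕ) (i : ℕ) :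
    0 ≤ ((twistDeriv ρ)^[N] P).coeff i ∧
      ((twistDeriv ρ)^[N] P).coeff i ≤ σ ^ N * (taylor (N / σ) P).coeff i := by
  induction N generalizing i with
  | zero => simp [hP]
  | succ N ih =>
    rw [Function.iterate_succ_apply', coeff_twistDeriv]
    have h1 := ih i
    have h2 := ih (i + 1)
    refine ⟨?_, ?_⟩
    · have := h1.1
      have := h2.1
      positivity
    · have hQ : ∀ i, 0 ≤ (taylor (N / σ) P).coeff i := coeff_taylor_nonneg hP (by positivity)
      have h3 := coeff_add_le_coeff_taylor hQ (h := 1 / σ) (by positivity) i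
      rw [taylor_taylor] at h3
      have h4 : (1 / σ + (N : ℝ) / σ) = ((N + 1 : ℕ) : ℝ) / σ := by push_cast; ring
      rw [add_comm, h4] at h3
      have h5 : 0 ≤ (taylor (N / σ) P).coeff i := hQ i
      calc _ ≤ σ ^ N * (taylor (N / σ) P).coeff (i + 1) * (i + 1) +
            σ * (σ ^ N * (taylor (N / σ) P).coeff i) := by
              gcongr
              · exact h2.2
              · exact h1.1
              · exact h1.2
        _ = σ ^ (N + 1) * ((taylor (N / σ) P).coeff (i + 1) * (i + 1) * (1 / σ) +
              (taylor (N / σ) P).coeff i) := by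
              field_simp
              ring
        _ ≤ _ := by gcongr

theorem abs_eval_iterate_twistDeriv_le {P : ℝ[X]} (hP : ∀ i, 0 ≤ P.coeff i) {ρ σ : ℝ}
    (hρ : 0 ≤ ρ) (hρσ : ρ ≤ σ) (hσ : 0 < σ) (N : ℕ) {x : ℝ} (hx : 0 ≤ x) :
    |((twistDeriv ρ)^[N] P).eval x| ≤ σ ^ N * P.eval (x + N / σ) := by
  have hc := coeff_iterate_twistDeriv_le hP hρ hρσ hσ N
  rw [← taylor_eval]
  set Q := (twistDeriv ρ)^[N] P
  set R := taylor (N / σ) P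
  set m := max Q.natDegree R.natDegree + 1
  rw [eval_eq_sum_range' (n := m) (by omega), eval_eq_sum_range' (n := m) (p := R) (by omega),
    Finset.mul_sum, abs_of_nonneg (Finset.sum_nonneg fun i _ => mul_nonneg (hc i).1 (by positivity))]
  refine Finset.sum_le_sum fun i _ => ?_
  rw [← mul_assoc]
  exact mul_le_mul_of_nonneg_right (hc i).2 (by positivity)

/-- The polynomial `(x + 1) (x + 2) ⋯ (x + u) / u!`. -/
noncomputable def risePoly (u : ℕ) : ℝ[X] :=
  C ((u.factorial : ℝ)⁻¹) * ∏ t ∈ Finset.range u, (X + C ((t : ℝ) + 1))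

theorem coeff_risePoly_nonneg (u i : ℕ) : 0 ≤ (risePoly u).coeff i := by
  rw [risePoly, coeff_C_mul]
  refine mul_nonneg (by positivity) ?_
  induction u generalizing i with
  | zero => simp [coeff_one]; split_ifs <;> norm_num
  | succ u ih =>
    rw [Finset.prod_range_succ, mul_add, coeff_add, coeff_mul_C]
    have := ih i
    refine add_nonneg ?_ (by positivity)
    cases i with
    | zero => simp
    | succ i => rw [coeff_mul_X]; exact ih i

theorem eval_risePoly (u : ℕ) (x : ℝ) :
    (risePoly u).eval x = (∏ t ∈ Finset.range u, (x + (t + 1))) / u.factorial := by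
  simp [risePoly, eval_prod, div_eq_inv_mul]

theorem eval_risePoly_natCast (u x : ℕ) :
    (risePoly u).eval (x : ℝ) = ((x + u).choose u : ℕ) := by
  rw [eval_risePoly, div_eq_iff (by positivity)]
  have h := Nat.ascFactorial_eq_factorial_mul_choose x u
  rw [Nat.ascFactorial_eq_prod_range] at h
  have h2 : (∏ t ∈ Finset.range u, ((x : ℝ) + (t + 1))) =
      ((∏ t ∈ Finset.range u, (x + 1 + t) : ℕ) : ℝ) := by
    push_cast
    exact Finset.prod_congr rfl fun t _ => by ring
  rw [h2, h]
  push_cast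
  ring

theorem eval_risePoly_nonneg (u : ℕ) {x : ℝ} (hx : 0 ≤ x) : 0 ≤ (risePoly u).eval x := by
  rw [eval_risePoly]; positivity

theorem natDegree_risePoly (u : ℕ) : (risePoly u).natDegree = u := by
  rw [risePoly, natDegree_C_mul (by positivity), natDegree_prod_of_monic _ _ fun t _ => monic_X_add_C _]
  simp only [natDegree_X_add_C, Finset.sum_const, Finset.card_range, smul_eq_mul, mul_one]

/-- For `u ≤ K` and `0 ≤ x + u ≤ y K` with `1 ≤ y`, the value at `x` is at most `(e y)^K`. -/
theorem eval_risePoly_le {u K : ℕ} (huK : u ≤ K) {x y : ℝ} (hx : 0 ≤ x) (hy : 1 ≤ y)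
    (hxy : x + u ≤ y * K) : (risePoly u).eval x ≤ (Real.exp 1 * y) ^ K := by
  have h1 : ∏ t ∈ Finset.range u, (x + ((t : ℝ) + 1)) ≤ (y * K) ^ u := by
    rw [← Finset.card_range u, ← Finset.prod_const]
    simp only [Finset.card_range]
    refine Finset.prod_le_prod (fun t _ => by positivity) fun t ht => le_trans ?_ hxy
    have : ((t + 1 : ℕ) : ℝ) ≤ u := by exact_mod_cast Finset.mem_range.1 ht
    push_cast at this
    linarith
  rw [eval_risePoly]
  calc _ ≤ (y * K) ^ u / u.factorial := by gcongr
    _ = y ^ u * ((K : ℝ) ^ u / u.factorial) := by rw [mul_pow]; ring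
    _ ≤ y ^ K * Real.exp K := by
      gcongr
      exact Real.pow_div_factorial_le_exp _ (by positivity) _
    _ = _ := by rw [mul_pow, ← Real.exp_nat_mul, mul_one, mul_comm]

/-- An exponential polynomial with distinct nonzero bases that vanishes at `0, 1, …, E - 1`, where
`E` is the sum of the degree bounds, has zero coefficients. -/
theorem eq_zero_of_exponential_polynomial_zeros {ι : Type*} [Fintype ι] (ρ : ι → ℝ)
    (hρ : Function.Injective ρ) (hρ0 : ∀ v, ρ v ≠ 0) (E : ℕ) (e : ι → ℕ) (hE : ∑ v, e v = E) (P : ι → ℝ[X])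
    (hP : ∀ v, (P v).degree < e v) (h : ∀ i < E, ∑ v, (P v).eval (i : ℝ) * ρ v ^ i = 0) :
    ∀ v, P v = 0 := by
  classical
  induction E generalizing e P with
  | zero =>
    intro v
    have : e v = 0 := by
      simpa using (Finset.sum_eq_zero_iff.1 hE) v (Finset.mem_univ v)
    have h1 := hP v
    rw [this] at h1
    exact degree_eq_bot.1 (Nat.WithBot.lt_zero_iff.1 (by simpa using h1))
  | succ E ih =>
    obtain ⟨w, hw⟩ : ∃ w, 0 < e w := by
      by_contra hcon
      push Not at hcon
      have : ∑ v, e v = 0 := Finset.sum_eq_zero fun v _ => by have := hcon v; omega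
      omega
    let Q : ι → ℝ[X] := fun v => C (ρ v) * taylor 1 (P v) - C (ρ w) * P v
    have hlead : ∀ v, P v ≠ 0 → (taylor 1 (P v)).coeff (P v).natDegree = (P v).leadingCoeff :=
      fun v _ => by rw [taylor_coeff, hasseDeriv_natDegree_eq_C, eval_C]
    have hQdeg : ∀ v, (Q v).degree ≤ (P v).degree := fun v => by
      refine (degree_sub_le _ _).trans (max_le ?_ ?_)
      · rw [degree_C_mul (hρ0 v), degree_taylor]
      · rw [degree_C_mul (hρ0 w)]
    have hQw : (Q w).degree < (e w - 1 : ℕ) := by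
      by_cases h0 : P w = 0
      · simp only [Q, h0, map_zero, mul_zero, sub_zero, degree_zero]
        exact WithBot.bot_lt_coe _
      · have hd : (P w).natDegree < e w := (natDegree_lt_iff_degree_lt h0).2 (hP w)
        have h1 : (Q w).degree < (P w).degree := by
          have hz := hρ0 w
          have := degree_sub_lt_left (p := C (ρ w) * taylor 1 (P w)) (q := C (ρ w) * P w)
            (by rw [degree_C_mul hz, degree_C_mul hz, degree_taylor])
            (mul_ne_zero (by simpa using hz) (by simpa using h0))
            (by rw [leadingCoeff_mul, leadingCoeff_mul]; simp)
          rwa [degree_C_mul hz, degree_taylor] at this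
        refine h1.trans_le ?_
        rw [degree_eq_natDegree h0]
        exact_mod_cast (by omega : (P w).natDegree ≤ e w - 1)
    have hQ0 := ih (Function.update e w (e w - 1))
      (by
        rw [Finset.sum_update_of_mem (Finset.mem_univ w)]
        rw [← Finset.add_sum_erase _ _ (Finset.mem_univ w), Finset.erase_eq] at hE
        omega) Q
      (by
        intro v
        by_cases hv : v = w
        · subst hv; simpa using hQw
        · rw [Function.update_of_ne hv]; exact (hQdeg v).trans_lt (hP v))
      (by
        intro i hi
        have h1 := h (i + 1) (by omega)
        have h2 := h i (by omega)
        have h3 : ∑ v, (Q v).eval (i : ℝ) * ρ v ^ i =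
            ∑ v, (P v).eval ((i + 1 : ℕ) : ℝ) * ρ v ^ (i + 1) -
              ρ w * ∑ v, (P v).eval (i : ℝ) * ρ v ^ i := by
          rw [Finset.mul_sum, ← Finset.sum_sub_distrib]
          refine Finset.sum_congr rfl fun v _ => ?_
          simp only [Q, eval_sub, eval_mul, eval_C, taylor_eval]
          push_cast
          ring
        rw [h3, h1, h2]; ring)
    have hv0 : ∀ v, v ≠ w → P v = 0 := by
      intro v hv
      by_contra h0
      have h1 := congrArg (fun R => coeff R (P v).natDegree) (hQ0 v)
      simp only [Q, coeff_sub, coeff_C_mul, hlead v h0, coeff_natDegree, coeff_zero] at h1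
      have h2 : (ρ v - ρ w) * (P v).leadingCoeff = 0 := by linarith
      rcases mul_eq_zero.1 h2 with h3 | h3
      · exact hv (hρ (sub_eq_zero.1 h3))
      · exact h0 (leadingCoeff_eq_zero.1 h3)
    have hw0 : P w = 0 := by
      have h1 : taylor 1 (P w) = P w := by
        have h2 : C (ρ w) * taylor 1 (P w) = C (ρ w) * P w := sub_eq_zero.1 (hQ0 w)
        exact mul_left_cancel₀ (by simpa using hρ0 w) h2
      have h2 : (P w).eval 0 = 0 := by
        have h3 := h 0 (by omega)
        rw [Finset.sum_eq_single w (fun v _ hv => by simp [hv0 v hv]) (by simp)] at h3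
        simpa using h3
      have h3 : ∀ i : ℕ, (P w).eval (i : ℝ) = 0 := by
        intro i
        induction i with
        | zero => simpa using h2
        | succ i hi =>
          rw [← h1, taylor_eval] at hi
          exact_mod_cast hi
      exact eq_zero_of_infinite_isRoot _
        ((Set.infinite_range_of_injective Nat.cast_injective).mono
          (Set.range_subset_iff.2 fun i => h3 i))
    intro v
    by_cases hv : v = w
    · rw [hv, hw0]
    · exact hv0 v hv

attribute [local instance] Matrix.seminormedAddCommGroup in
/-- Siegel's lemma with twice as many unknowns as equations. -/
theorem exists_ne_zero_mulVec_eq_zero_abs_le {ι κ : Type*} [Fintype ι] [Fintype κ]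
    (A : Matrix ι κ ℤ) (hpos : 0 < Fintype.card ι) (hcard : Fintype.card κ = 2 * Fintype.card ι)
    {M : ℝ} (hM : 1 ≤ M) (hA : ∀ i j, |(A i j : ℝ)| ≤ M) :
    ∃ t : κ → ℤ, t ≠ 0 ∧ A.mulVec t = 0 ∧ ∀ j, |(t j : ℝ)| ≤ Fintype.card κ * M := by
  obtain ⟨t, ht0, ht, hle⟩ :=
    Int.Matrix.exists_ne_zero_int_vec_norm_le A (by omega) hpos
  refine ⟨t, ht0, ht, fun j => ?_⟩
  have hnorm : ‖A‖ ≤ M := by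
    rw [Matrix.norm_le_iff (by linarith)]
    intro i j
    rw [Int.norm_eq_abs]
    exact hA i j
  have hexp : ((Fintype.card ι : ℝ) / ((Fintype.card κ : ℝ) - Fintype.card ι)) = 1 := by
    have : (0 : ℝ) < Fintype.card ι := by exact_mod_cast hpos
    rw [hcard]; push_cast
    rw [div_eq_one_iff_eq (by linarith)]; ring
  rw [hexp, Real.rpow_one] at hle
  have h1 := (norm_le_pi_norm t j).trans hle
  rw [Int.norm_eq_abs] at h1
  refine h1.trans ?_
  gcongr
  exact max_le hM hnorm

theorem prod_abs_sub_eq (S i : ℕ) (hi : i < S) :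
    ∏ t ∈ Finset.range S, (if t = i then (1 : ℝ) else |(i : ℝ) - t|) =
      (i.factorial * (S - 1 - i).factorial : ℕ) := by
  obtain ⟨m, rfl⟩ : ∃ m, S = i + 1 + m := ⟨S - 1 - i, by omega⟩
  rw [Finset.prod_range_add, Finset.prod_range_succ]
  simp only [if_true, mul_one]
  rw [show i + 1 + m - 1 - i = m by omega]
  push_cast
  congr 1
  · rw [← Finset.prod_range_reflect, ← Finset.prod_range_add_one_eq_factorial]
    push_cast
    refine Finset.prod_congr rfl fun t ht => ?_
    have ht' := Finset.mem_range.1 ht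
    rw [if_neg (by omega), Nat.sub_sub, Nat.cast_sub (by omega), abs_of_nonneg]
    · push_cast; ring
    · push_cast
      have : (t : ℝ) ≥ 0 := by positivity
      linarith
  · rw [← Finset.prod_range_add_one_eq_factorial]
    push_cast
    refine Finset.prod_congr rfl fun t _ => ?_
    rw [if_neg (by omega), abs_of_nonpos]
    · ring
    · have : (t : ℝ) ≥ 0 := by positivity
      linarith

theorem prod_cluster_le (S i : ℕ) (hi : i < S) {J n : ℝ} (hJ : 1 ≤ J) (hn : 0 < n) :
    ∏ t ∈ Finset.range S, (if t = i then (1 : ℝ) else J * n / |(i : ℝ) - t|) ≤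
      (2 * J ^ 2) ^ S * Real.exp (n / J) := by
  have h1 : ∏ t ∈ Finset.range S, (if t = i then (1 : ℝ) else J * n / |(i : ℝ) - t|) =
      (J * n) ^ (S - 1) / ∏ t ∈ Finset.range S, (if t = i then (1 : ℝ) else |(i : ℝ) - t|) := by
    have h2 : (J * n) ^ (S - 1) =
        ∏ t ∈ Finset.range S, (if t = i then (1 : ℝ) else J * n) := by
      rw [← Finset.mul_prod_erase _ _ (Finset.mem_range.2 hi), if_pos rfl, one_mul,
        Finset.prod_congr rfl (g := fun _ => J * n)
          (fun t ht => if_neg (Finset.ne_of_mem_erase ht)), Finset.prod_const,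
        Finset.card_erase_of_mem (Finset.mem_range.2 hi), Finset.card_range]
    rw [h2, ← Finset.prod_div_distrib]
    refine Finset.prod_congr rfl fun t _ => ?_
    split_ifs <;> simp
  rw [h1, prod_abs_sub_eq S i hi]
  have h3 : ((S - 1).factorial : ℝ) ≤
      2 ^ (S - 1) * (i.factorial * (S - 1 - i).factorial : ℕ) := by
    have h4 := Nat.choose_mul_factorial_mul_factorial (show i ≤ S - 1 by omega)
    have h5 : (S - 1).choose i ≤ 2 ^ (S - 1) := Nat.choose_le_two_pow _ _
    rw [← h4, mul_assoc]
    exact_mod_cast Nat.mul_le_mul_right _ h5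
  have h6 : (0 : ℝ) < (i.factorial * (S - 1 - i).factorial : ℕ) := by positivity
  have h7 : (0 : ℝ) < (S - 1).factorial := by positivity
  have hJ0 : 0 < J := by linarith
  calc _ ≤ 2 ^ (S - 1) * ((J * n) ^ (S - 1) / (S - 1).factorial) := by
        rw [div_le_iff₀ h6, mul_comm (2 ^ (S - 1) : ℝ), mul_assoc, div_mul_eq_mul_div,
          le_div_iff₀ h7]
        gcongr
    _ = (2 * J ^ 2) ^ (S - 1) * ((n / J) ^ (S - 1) / (S - 1).factorial) := by
        rw [← mul_div_assoc, ← mul_div_assoc, ← mul_pow, ← mul_pow]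
        congr 2
        field_simp
    _ ≤ (2 * J ^ 2) ^ S * Real.exp (n / J) := by
        gcongr
        · nlinarith
        · omega
        · exact Real.pow_div_factorial_le_exp _ (by positivity) _

/-- Bound for the Lagrange basis polynomials of `J` blocks of `S` consecutive integers spaced
by `n ≥ 2 S`. -/
theorem abs_eval_lagrange_basis_le {S J n : ℕ} (hn : 2 * S ≤ n) {x : ℝ} (hx0 : 0 ≤ x)
    (hx : x ≤ J * n) {p : ℕ × ℕ} (hp : p ∈ Finset.range S ×ˢ Finset.range J) :
    |(Lagrange.basis (Finset.range S ×ˢ Finset.range J)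
        (fun q : ℕ × ℕ => (q.1 : ℝ) + q.2 * n) p).eval x| ≤
      (2 * J : ℝ) ^ (S * J) * ((2 * (J : ℝ) ^ 2) ^ S * Real.exp (n / J)) := by
  obtain ⟨hp1, hp2⟩ := Finset.mem_product.1 hp
  rw [Finset.mem_range] at hp1 hp2
  have hJ : (1 : ℝ) ≤ J := by exact_mod_cast (by omega : 1 ≤ J)
  have hn0 : (0 : ℝ) < n := by exact_mod_cast (by omega : 0 < n)
  have hSn : (2 * S : ℝ) ≤ n := by exact_mod_cast hn
  set vv : ℕ × ℕ → ℝ := fun q => (q.1 : ℝ) + q.2 * n with hvv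
  have hnum : ∀ q ∈ Finset.range S ×ˢ Finset.range J, |x - vv q| ≤ J * n := by
    intro q hq
    obtain ⟨hq1, hq2⟩ := Finset.mem_product.1 hq
    rw [Finset.mem_range] at hq1 hq2
    have h1 : (q.1 : ℝ) ≤ S := by exact_mod_cast hq1.le
    have h2 : (q.2 : ℝ) + 1 ≤ J := by exact_mod_cast hq2
    have h3 : ((q.2 : ℝ) + 1) * n ≤ J * n := by gcongr
    have h4 : (0 : ℝ) ≤ q.2 * n := by positivity
    have h5 : (0 : ℝ) ≤ q.1 := by positivity
    rw [abs_le]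
    constructor <;> simp only [hvv] <;> nlinarith
  have h1 : |(Lagrange.basis (Finset.range S ×ˢ Finset.range J) vv p).eval x| =
      ∏ q ∈ Finset.range S ×ˢ Finset.range J,
        (if q = p then (1 : ℝ) else |x - vv q| / |vv p - vv q|) := by
    rw [← Finset.mul_prod_erase _ _ hp, if_pos rfl, one_mul, Lagrange.basis, eval_prod,
      Finset.abs_prod]
    refine Finset.prod_congr rfl fun q hq => ?_
    rw [if_neg (Finset.ne_of_mem_erase hq), Lagrange.basisDivisor]
    simp [abs_mul, abs_inv, div_eq_inv_mul]
  rw [h1, Finset.prod_product_right]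
  have hblock : ∀ j ∈ Finset.range J, ∏ i ∈ Finset.range S,
      (if (i, j) = p then (1 : ℝ) else |x - vv (i, j)| / |vv p - vv (i, j)|) ≤
      (if j = p.2 then (2 * (J : ℝ) ^ 2) ^ S * Real.exp (n / J) else 1) * (2 * J : ℝ) ^ S := by
    intro j hj
    by_cases hjp : j = p.2
    · rw [if_pos hjp]
      have hone : (1 : ℝ) ≤ (2 * J : ℝ) ^ S := one_le_pow₀ (by linarith)
      refine le_trans ?_ (le_mul_of_one_le_right (by positivity) hone)
      refine le_trans (Finset.prod_le_prod (fun i _ => ?_) fun i hi => ?_)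
        (prod_cluster_le S p.1 hp1 hJ hn0)
      · split_ifs <;> positivity
      · by_cases hip : i = p.1
        · rw [if_pos (Prod.ext hip hjp), if_pos hip]
        · rw [if_neg (fun h => hip (congrArg Prod.fst h)), if_neg hip]
          have : vv p - vv (i, j) = p.1 - i := by simp only [hvv, hjp]; ring
          rw [this]
          gcongr
          exact hnum _ (Finset.mk_mem_product hi hj)
    · rw [if_neg hjp, one_mul, ← Finset.card_range S, ← Finset.prod_const]
      simp only [Finset.card_range]
      refine Finset.prod_le_prod (fun i _ => by split_ifs <;> positivity) fun i hi => ?_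
      rw [if_neg (fun h => hjp (congrArg Prod.snd h))]
      have hi' : (i : ℝ) ≤ S := by exact_mod_cast (Finset.mem_range.1 hi).le
      have hp1' : (p.1 : ℝ) ≤ S := by exact_mod_cast hp1.le
      have hi0 : (0 : ℝ) ≤ i := by positivity
      have hp0 : (0 : ℝ) ≤ p.1 := by positivity
      have hden : (n : ℝ) / 2 ≤ |vv p - vv (i, j)| := by
        simp only [hvv]
        rcases lt_or_gt_of_ne hjp with h | h
        · have : (j : ℝ) + 1 ≤ p.2 := by exact_mod_cast h
          have : ((j : ℝ) + 1) * n ≤ p.2 * n := by gcongr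
          refine le_trans ?_ (le_abs_self _)
          linarith
        · have : (p.2 : ℝ) + 1 ≤ j := by exact_mod_cast h
          have : ((p.2 : ℝ) + 1) * n ≤ j * n := by gcongr
          refine le_trans ?_ (neg_le_abs _)
          linarith
      rw [div_le_iff₀ (by linarith)]
      calc _ ≤ (J : ℝ) * n := hnum _ (Finset.mk_mem_product hi hj)
        _ = 2 * J * (n / 2) := by ring
        _ ≤ _ := by gcongr
  refine (Finset.prod_le_prod (fun j _ => Finset.prod_nonneg fun i _ => ?_) hblock).trans ?_
  · split_ifs <;> positivity
  · rw [Finset.prod_mul_distrib, Finset.prod_const, Finset.card_range, Finset.prod_ite_eq',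
      if_pos (Finset.mem_range.2 hp2), ← pow_mul, mul_comm]

/-- The `m`-th derivative of `∑ p u v * risePoly u x * exp (v lam x)`. -/
noncomputable def auxFun {K L : ℕ} (p : Fin K × Fin L → ℤ) (lam : ℝ) (m : ℕ) (x : ℝ) : ℝ :=
  ∑ w, (p w : ℝ) *
    (((twistDeriv (w.2 * lam))^[m] (risePoly w.1)).eval x * Real.exp (w.2 * lam * x))

/-- The value at the point `i + j n`, with `α ^ n` replaced by `β` in the exponential factors. -/
noncomputable def auxVal {K L : ℕ} (p : Fin K × Fin L → ℤ) (α β : ℝ) (n i j : ℕ) : ℝ :=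
  ∑ w, (p w : ℝ) *
    ((risePoly w.1).eval ((i : ℝ) + j * n) * (α ^ ((w.2 : ℕ) * i) * β ^ ((w.2 : ℕ) * j)))

theorem hasDerivAt_auxFun {K L : ℕ} (p : Fin K × Fin L → ℤ) (lam : ℝ) (m : ℕ) (x : ℝ) :
    HasDerivAt (auxFun p lam m) (auxFun p lam (m + 1) x) x := by
  unfold auxFun
  refine HasDerivAt.fun_sum fun w _ => ?_
  have := (hasDerivAt_eval_mul_exp (w.2 * lam) ((twistDeriv (w.2 * lam))^[m] (risePoly w.1))
    x).const_mul (p w : ℝ)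
  simpa only [Function.iterate_succ_apply'] using this

theorem abs_sum_le_card_mul {ι : Type*} [Fintype ι] (f g : ι → ℝ) {H M : ℝ} (hH : 0 ≤ H)
    (hf : ∀ i, |f i| ≤ H) (hg : ∀ i, |g i| ≤ M) :
    |∑ i, f i * g i| ≤ Fintype.card ι * (H * M) := by
  refine (Finset.abs_sum_le_sum_abs _ _).trans ?_
  rw [← Finset.card_univ, ← nsmul_eq_mul]
  refine Finset.sum_le_card_nsmul _ _ _ fun i _ => ?_
  rw [abs_mul]
  exact mul_le_mul (hf i) (hg i) (abs_nonneg _) hH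

theorem abs_auxFun_le {K L : ℕ} {p : Fin K × Fin L → ℤ} {H : ℝ} (hH : 0 ≤ H)
    (hp : ∀ w, |(p w : ℝ)| ≤ H) {lam σ P E x : ℝ} (hlam : 0 ≤ lam) (hσ : 0 < σ)
    (hσL : L * lam ≤ σ) (N : ℕ) (hx : 0 ≤ x)
    (hP : ∀ u < K, (risePoly u).eval (x + N / σ) ≤ P) (hE : Real.exp (L * lam * x) ≤ E) :
    |auxFun p lam N x| ≤ K * L * (H * (σ ^ N * P * E)) := by
  unfold auxFun
  have := abs_sum_le_card_mul (fun w => (p w : ℝ))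
    (fun w => (((twistDeriv (w.2 * lam))^[N] (risePoly w.1)).eval x * Real.exp (w.2 * lam * x)))
    hH hp (M := σ ^ N * P * E) fun w => ?_
  · simpa using this
  · have hv : ((w.2 : ℕ) : ℝ) ≤ L := by exact_mod_cast w.2.2.le
    have h1 : (w.2 : ℝ) * lam ≤ L * lam := by gcongr
    have h2 := abs_eval_iterate_twistDeriv_le (coeff_risePoly_nonneg w.1)
      (ρ := w.2 * lam) (σ := σ) (by positivity) (h1.trans hσL) hσ N hx
    rw [abs_mul, abs_of_pos (Real.exp_pos _)]
    have hP0 : 0 ≤ P := (eval_risePoly_nonneg w.1 (by positivity)).trans (hP w.1 w.1.2)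
    refine mul_le_mul (h2.trans ?_) (le_trans ?_ hE) (Real.exp_pos _).le (by positivity)
    · gcongr
      exact hP w.1 w.1.2
    · gcongr

theorem abs_auxFun_sub_auxVal_le {K L : ℕ} {p : Fin K × Fin L → ℤ} {H : ℝ} (hH : 0 ≤ H)
    (hp : ∀ w, |(p w : ℝ)| ≤ H) {α β lam P E : ℝ} (hα : α = Real.exp lam) (n i j : ℕ)
    (hP : ∀ u < K, (risePoly u).eval ((i : ℝ) + j * n) ≤ P)
    (hE : ∀ v < L, α ^ (v * i) * |(α ^ n) ^ (v * j) - β ^ (v * j)| ≤ E) :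
    |auxFun p lam 0 (i + j * n) - auxVal p α β n i j| ≤ K * L * (H * (P * E)) := by
  unfold auxFun auxVal
  have hα0 : 0 < α := hα ▸ Real.exp_pos _
  rw [← Finset.sum_sub_distrib]
  have := abs_sum_le_card_mul (fun w => (p w : ℝ))
    (fun w => ((risePoly w.1).eval ((i : ℝ) + j * n) * (α ^ ((w.2 : ℕ) * i) *
      ((α ^ n) ^ ((w.2 : ℕ) * j) - β ^ ((w.2 : ℕ) * j)))))
    hH hp (M := P * E) fun w => ?_
  · have hcongr : ∀ w : Fin K × Fin L, (p w : ℝ) *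
        (((twistDeriv (w.2 * lam))^[0] (risePoly w.1)).eval ((i : ℝ) + j * n) *
          Real.exp (w.2 * lam * (i + j * n))) - (p w : ℝ) *
        ((risePoly w.1).eval ((i : ℝ) + j * n) * (α ^ ((w.2 : ℕ) * i) * β ^ ((w.2 : ℕ) * j))) =
        (p w : ℝ) * ((risePoly w.1).eval ((i : ℝ) + j * n) * (α ^ ((w.2 : ℕ) * i) *
          ((α ^ n) ^ ((w.2 : ℕ) * j) - β ^ ((w.2 : ℕ) * j)))) := by
      intro w
      have h1 : Real.exp (w.2 * lam * (i + j * n)) =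
          α ^ ((w.2 : ℕ) * i) * (α ^ n) ^ ((w.2 : ℕ) * j) := by
        rw [hα, ← pow_mul, ← Real.exp_nat_mul, ← Real.exp_nat_mul, ← Real.exp_add]
        congr 1
        push_cast
        ring
      rw [h1, Function.iterate_zero, id]
      ring
    rw [Finset.sum_congr rfl fun w _ => hcongr w]
    simpa using this
  · have h0 := eval_risePoly_nonneg w.1 (x := (i : ℝ) + j * n) (by positivity)
    rw [abs_mul, abs_mul, abs_of_nonneg h0, abs_of_nonneg (by positivity : 0 ≤ α ^ ((w.2 : ℕ) * i))]
    exact mul_le_mul (hP w.1 w.1.2) (hE w.2 w.2.2) (by positivity) (h0.trans (hP w.1 w.1.2))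

/-- If the auxiliary values vanish on `J` blocks of `S` points, the next ones are small. -/
theorem abs_auxVal_le_of_vanish {K L : ℕ} {p : Fin K × Fin L → ℤ} {H : ℝ} (hH : 0 ≤ H)
    (hp : ∀ w, |(p w : ℝ)| ≤ H) {α β lam σ P₁ E₁ P₂ E₂ : ℝ} (hα : α = Real.exp lam)
    (hlam : 0 ≤ lam) (hσ : 0 < σ) (hσL : L * lam ≤ σ) {n S J : ℕ} (hS : 0 < S) (hSn : 2 * S ≤ n)
    (hP₁ : ∀ u < K, ∀ i ≤ S, ∀ j < J, (risePoly u).eval ((i : ℝ) + j * n) ≤ P₁)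
    (hE₁ : ∀ v < L, ∀ i ≤ S, ∀ j < J, α ^ (v * i) * |(α ^ n) ^ (v * j) - β ^ (v * j)| ≤ E₁)
    (hP₂ : ∀ u < K, ∀ x : ℝ, 0 ≤ x → x ≤ J * n →
      (risePoly u).eval (x + (S * J : ℕ) / σ) ≤ P₂)
    (hE₂ : Real.exp (L * lam * (J * n)) ≤ E₂)
    (hV : ∀ i < S, ∀ j < J, auxVal p α β n i j = 0) {j : ℕ} (hj : j < J) :
    |auxVal p α β n S j| ≤
      K * L * (H * (P₁ * E₁)) * (1 + (S * J : ℕ) *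
        ((2 * J : ℝ) ^ (S * J) * ((2 * (J : ℝ) ^ 2) ^ S * Real.exp (n / J)))) +
      K * L * (H * (σ ^ (S * J) * P₂ * E₂)) / (S * J).factorial * (J * n : ℝ) ^ (S * J) := by
  set s := Finset.range S ×ˢ Finset.range J with hs
  set vv : ℕ × ℕ → ℝ := fun q => (q.1 : ℝ) + q.2 * n with hvv
  set ε : ℝ := K * L * (H * (P₁ * E₁)) with hε
  have hn0 : (0 : ℝ) < n := by exact_mod_cast (by omega : 0 < n)
  have hSn' : (2 * S : ℝ) ≤ n := by exact_mod_cast hSn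
  have hcard : s.card = S * J := by simp [hs]
  have hmem : ∀ q : ℕ × ℕ, q.1 ≤ S → q.2 < J → vv q ∈ Set.Icc (0 : ℝ) (J * n) := by
    intro q hq1 hq2
    have h1 : (q.1 : ℝ) ≤ S := by exact_mod_cast hq1
    have h2 : (q.2 : ℝ) + 1 ≤ J := by exact_mod_cast hq2
    have h3 : ((q.2 : ℝ) + 1) * n ≤ J * n := by gcongr
    have h4 : (0 : ℝ) ≤ S := by positivity
    refine ⟨by simp only [hvv]; positivity, ?_⟩
    simp only [hvv]; linarith
  have hinj : ∀ q q' : ℕ × ℕ, q.1 ≤ S → q'.1 ≤ S → vv q = vv q' → q = q' := by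
    intro q q' hq hq' h
    have h1 : q.1 + q.2 * n = q'.1 + q'.2 * n := by
      simp only [hvv] at h; exact_mod_cast h
    have hlt : q.1 < n := by omega
    have hlt' : q'.1 < n := by omega
    have h2 : q.1 = q'.1 := by
      have := congrArg (· % n) h1
      simpa [Nat.add_mul_mod_self_right, Nat.mod_eq_of_lt hlt, Nat.mod_eq_of_lt hlt'] using this
    have h3 : q.2 = q'.2 := by
      rw [h2] at h1
      exact Nat.eq_of_mul_eq_mul_right (by omega) (Nat.add_left_cancel h1)
    exact Prod.ext h2 h3
  have hmem' : ∀ q ∈ s, q.1 < S ∧ q.2 < J := fun q hq => by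
    simpa [hs] using hq
  have hclose : ∀ i ≤ S, ∀ j < J,
      |auxFun p lam 0 (i + j * n) - auxVal p α β n i j| ≤ ε := fun i hi j hj =>
    abs_auxFun_sub_auxVal_le hH hp hα n i j (fun u hu => hP₁ u hu i hi j hj)
      fun v hv => hE₁ v hv i hi j hj
  obtain ⟨ξ, hξ, heq⟩ := exists_eq_interpolate_add s vv
    (fun q hq q' hq' h => hinj q q' (hmem' q hq).1.le (hmem' q' hq').1.le h)
    (auxFun p lam) (hasDerivAt_auxFun p lam) (x := vv (S, j)) (hmem (S, j) le_rfl hj)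
    (fun q hq h => by
      have := hinj (S, j) q le_rfl (hmem' q hq).1.le h
      have h2 := (hmem' q hq).1
      rw [← this] at h2
      exact lt_irrefl _ h2)
    (fun q hq => hmem q (hmem' q hq).1.le (hmem' q hq).2)
  rw [hcard] at heq
  set G : ℝ := (2 * J : ℝ) ^ (S * J) * ((2 * (J : ℝ) ^ 2) ^ S * Real.exp (n / J)) with hG
  have hxmem := hmem (S, j) le_rfl hj
  have hint : |(Lagrange.interpolate s vv fun i => auxFun p lam 0 (vv i)).eval (vv (S, j))| ≤
      (S * J : ℕ) * (ε * G) := by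
    rw [Lagrange.interpolate_apply, eval_finsetSum, ← hcard, ← nsmul_eq_mul]
    refine (Finset.abs_sum_le_sum_abs _ _).trans (Finset.sum_le_card_nsmul _ _ _ fun q hq => ?_)
    rw [eval_mul, eval_C, abs_mul]
    have h1 := hclose q.1 (hmem' q hq).1.le q.2 (hmem' q hq).2
    rw [hV q.1 (hmem' q hq).1 q.2 (hmem' q hq).2, sub_zero] at h1
    exact mul_le_mul h1 (abs_eval_lagrange_basis_le hSn hxmem.1 hxmem.2 hq) (abs_nonneg _)
      ((abs_nonneg _).trans h1)
  have hprod : |∏ q ∈ s, (vv (S, j) - vv q)| ≤ (J * n : ℝ) ^ (S * J) := by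
    rw [Finset.abs_prod, ← hcard, ← Finset.prod_const]
    refine Finset.prod_le_prod (fun q _ => abs_nonneg _) fun q hq => ?_
    have h2 := hmem q (hmem' q hq).1.le (hmem' q hq).2
    rw [abs_le]
    constructor <;> linarith [h2.1, h2.2, hxmem.1, hxmem.2]
  have hder : |auxFun p lam (S * J) ξ| ≤ K * L * (H * (σ ^ (S * J) * P₂ * E₂)) := by
    refine abs_auxFun_le hH hp hlam hσ hσL (S * J) hξ.1 (fun u hu => hP₂ u hu ξ hξ.1 hξ.2)
      (le_trans ?_ hE₂)
    gcongr
    exact hξ.2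
  have hlast := hclose S le_rfl j hj
  have hF : |auxFun p lam 0 (vv (S, j))| ≤ (S * J : ℕ) * (ε * G) +
      K * L * (H * (σ ^ (S * J) * P₂ * E₂)) / (S * J).factorial * (J * n : ℝ) ^ (S * J) := by
    rw [heq]
    refine (abs_add_le _ _).trans (add_le_add hint ?_)
    rw [abs_mul, abs_div, Nat.abs_cast]
    refine mul_le_mul ?_ hprod (abs_nonneg _) ?_
    · gcongr
    · exact div_nonneg ((abs_nonneg _).trans hder) (by positivity)
  have h5 : |auxVal p α β n S j| ≤ |auxFun p lam 0 (vv (S, j))| + ε := by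
    have h6 : auxVal p α β n S j = auxFun p lam 0 (vv (S, j)) -
      (auxFun p lam 0 (S + j * n) - auxVal p α β n S j) := by simp only [hvv]; ring
    rw [h6]
    exact (abs_sub _ _).trans (add_le_add_right hlast _)
  linarith

/-- Clearing the denominators of an auxiliary value. -/
theorem auxVal_mul_eq {K L : ℕ} (p : Fin K × Fin L → ℤ) {b c B s : ℕ} (hb : 0 < b) (hs : 0 < s)
    (n i j : ℕ) :
    auxVal p ((c : ℝ) / b) ((B : ℝ) / s) n i j * ((b : ℝ) ^ (L * i) * (s : ℝ) ^ (L * j)) =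
      (∑ w : Fin K × Fin L, ((i + j * n + w.1).choose w.1 *
        (c ^ ((w.2 : ℕ) * i) * b ^ ((L - w.2) * i) *
          (B ^ ((w.2 : ℕ) * j) * s ^ ((L - w.2) * j))) : ℕ) * p w : ℤ) := by
  have hb' : (b : ℝ) ≠ 0 := by positivity
  have hs' : (s : ℝ) ≠ 0 := by positivity
  rw [auxVal, Finset.sum_mul]
  push_cast
  refine Finset.sum_congr rfl fun w _ => ?_
  have h1 := eval_risePoly_natCast w.1 (i + j * n)
  push_cast at h1
  rw [h1]
  have hL : L = w.2 + (L - w.2) := by omega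
  have e1 : (b : ℝ) ^ (L * i) = b ^ ((w.2 : ℕ) * i) * b ^ ((L - w.2) * i) := by
    rw [← pow_add, ← add_mul, ← hL]
  have e2 : (s : ℝ) ^ (L * j) = s ^ ((w.2 : ℕ) * j) * s ^ ((L - w.2) * j) := by
    rw [← pow_add, ← add_mul, ← hL]
  rw [e1, e2, div_pow, div_pow]
  field_simp

/-- A value with the stated denominators that is small enough vanishes. -/
theorem auxVal_eq_zero_of_abs_lt {K L : ℕ} (p : Fin K × Fin L → ℤ) {b c B s : ℕ} (hb : 0 < b)
    (hs : 0 < s) (n i j : ℕ)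
    (h : |auxVal p ((c : ℝ) / b) ((B : ℝ) / s) n i j| * ((b : ℝ) ^ (L * i) * (s : ℝ) ^ (L * j)) < 1) :
    auxVal p ((c : ℝ) / b) ((B : ℝ) / s) n i j = 0 := by
  have hzeq := auxVal_mul_eq p hb hs n i j (c := c) (B := B)
  set z : ℤ := ∑ w : Fin K × Fin L, ((i + j * n + w.1).choose w.1 *
        (c ^ ((w.2 : ℕ) * i) * b ^ ((L - w.2) * i) *
          (B ^ ((w.2 : ℕ) * j) * s ^ ((L - w.2) * j))) : ℕ) * p w
  have h2 : |(z : ℝ)| < 1 := by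
    rw [← hzeq, abs_mul, abs_of_pos (by positivity : (0 : ℝ) < (b : ℝ) ^ (L * i) * (s : ℝ) ^ (L * j))]
    exact h
  have h3 : z = 0 := by
    rw [← Int.cast_abs] at h2
    exact Int.abs_lt_one_iff.1 (by exact_mod_cast h2)
  rw [h3, Int.cast_zero] at hzeq
  exact (mul_eq_zero.1 hzeq).resolve_right (by positivity)

/-- If all auxiliary values at `0, …, K L - 1` vanish, so do the coefficients. -/
theorem eq_zero_of_auxVal_eq_zero {K L : ℕ} (p : Fin K × Fin L → ℤ) {α β : ℝ} (hα : 1 < α) (n : ℕ)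
    (h : ∀ i < K * L, auxVal p α β n i 0 = 0) : p = 0 := by
  have h1 := eq_zero_of_exponential_polynomial_zeros (fun v : Fin L => α ^ (v : ℕ))
    (fun v v' hv => Fin.ext (pow_right_injective₀ (by linarith) hα.ne' hv))
    (fun v => by positivity) (K * L) (fun _ => K) (by simp [mul_comm])
    (fun v => ∑ u : Fin K, C (p (u, v) : ℝ) * risePoly u)
    (fun v => by
      refine (degree_sum_le _ _).trans_lt ?_
      rw [Finset.sup_lt_iff (WithBot.bot_lt_coe _)]
      intro u _
      refine (degree_le_natDegree).trans_lt ?_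
      refine lt_of_le_of_lt (b := ((u : ℕ) : WithBot ℕ)) ?_ (by exact_mod_cast u.2)
      exact_mod_cast (natDegree_C_mul_le _ _).trans (natDegree_risePoly u).le)
    (fun i hi => by
      rw [← h i hi, auxVal, Fintype.sum_prod_type_right]
      refine Finset.sum_congr rfl fun v _ => ?_
      rw [eval_finsetSum, Finset.sum_mul]
      refine Finset.sum_congr rfl fun u _ => ?_
      simp only [eval_mul, eval_C, Nat.cast_zero, zero_mul, add_zero, mul_zero, pow_zero, mul_one,
        ← pow_mul]
      ring)
  let R : Polynomial.Sequence ℝ := ⟨risePoly, fun u => by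
    rcases Nat.eq_zero_or_pos u with rfl | hu
    · have h0 : risePoly 0 ≠ 0 := fun h0 => by
        have := eval_risePoly_natCast 0 0
        rw [h0] at this
        simp at this
      rw [degree_eq_natDegree h0, natDegree_risePoly]
    · exact (degree_eq_iff_natDegree_eq_of_pos hu).2 (natDegree_risePoly u)⟩
  have hR := Fintype.linearIndependent_iff.1
    (R.linearIndependent.comp (Fin.val : Fin K → ℕ) Fin.val_injective)
  funext w
  have h2 := hR (fun u => (p (u, w.2) : ℝ)) (by simpa [smul_eq_C_mul] using h1 w.2) w.1
  exact_mod_cast h2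

/-- A power divided by a factorial, optimised through the exponential series. -/
theorem pow_div_factorial_le_exp_mul {y t : ℝ} {N : ℕ} (hy : 0 ≤ y) (ht : 0 < t)
    (h : t * y ≤ N) : y ^ N / N.factorial ≤ Real.exp N * (t⁻¹) ^ N := by
  have h1 : (t * y) ^ N / N.factorial ≤ Real.exp (t * y) :=
    Real.pow_div_factorial_le_exp (t * y) (by positivity) N
  have h2 : y ^ N / N.factorial = (t * y) ^ N / N.factorial * (t⁻¹) ^ N := by
    rw [mul_pow, inv_pow]
    field_simp
  rw [h2]
  gcongr
  exact h1.trans (Real.exp_le_exp.2 h)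

/-- Consequences of `r b ^ (n + k)` and `s c ^ n` being close. -/
theorem size_of_close {b c r s k n : ℕ} (hb : 2 ^ 96 ≤ b) (hbc : b < c)
    (hδ : ((c : ℝ) - b) ^ 2 ≤ 4 * b) (hr : 1 ≤ r) (hs : 1 ≤ s) (hs2 : (s : ℝ) ^ 2 ≤ 4 * b)
    (hk : 1 ≤ k) (hn : 1 ≤ n) (h : |(r : ℝ) * b ^ (n + k) - s * c ^ n| ≤ 4 * b) :
    0 < Real.log ((c : ℝ) / b) ∧ Real.log ((c : ℝ) / b) * √(b : ℝ) ≤ 2 ∧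
    |((c : ℝ) / b) ^ n - ((b ^ k * r : ℕ) : ℝ) / s| ≤ 4 * b / (b : ℝ) ^ n ∧
    ((b ^ k * r : ℕ) : ℝ) / s ≤ 2 * ((c : ℝ) / b) ^ n ∧
    23 * (Real.log b * √(b : ℝ)) ≤ 96 * n := by
  have hbR : (2 : ℝ) ^ 96 ≤ b := by exact_mod_cast hb
  have hb0 : (0 : ℝ) < b := lt_of_lt_of_le (by positivity) hbR
  have hs0 : (1 : ℝ) ≤ s := by exact_mod_cast hs
  have hr0 : (1 : ℝ) ≤ r := by exact_mod_cast hr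
  have hbc' : (b : ℝ) < c := by exact_mod_cast hbc
  set R := √(b : ℝ) with hR
  have hRR : R * R = b := Real.mul_self_sqrt hb0.le
  have hR48 : (2 : ℝ) ^ 48 ≤ R := Real.le_sqrt_of_sq_le (by norm_num at hbR ⊢; exact hbR)
  have hR0 : 0 < R := lt_of_lt_of_le (by positivity) hR48
  have hδ' : (c : ℝ) - b ≤ 2 * R := by
    refine abs_le_of_sq_le_sq' (b := 2 * R) ?_ (by positivity) |>.2
    nlinarith
  have hs' : (s : ℝ) ≤ 2 * R := by
    refine abs_le_of_sq_le_sq' (b := 2 * R) ?_ (by positivity) |>.2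
    nlinarith
  have hα1 : 1 < (c : ℝ) / b := (one_lt_div hb0).2 hbc'
  have hlam0 := Real.log_pos hα1
  have hlam : Real.log ((c : ℝ) / b) * R ≤ 2 := by
    have h1 := Real.log_le_sub_one_of_pos (lt_trans one_pos hα1)
    have h2 : ((c : ℝ) / b - 1) * R = (c - b) / R := by
      rw [← hRR]; field_simp
    have h3 : ((c : ℝ) - b) / R ≤ 2 := by rw [div_le_iff₀ hR0]; exact hδ'
    nlinarith
  have hclose : |((c : ℝ) / b) ^ n - ((b ^ k * r : ℕ) : ℝ) / s| ≤ 4 * b / (b : ℝ) ^ n := by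
    have h1 : ((c : ℝ) / b) ^ n - ((b ^ k * r : ℕ) : ℝ) / s =
        -((r : ℝ) * b ^ (n + k) - s * c ^ n) / (s * b ^ n) := by
      push_cast
      rw [div_pow, pow_add]
      field_simp
      ring
    rw [h1, abs_div, abs_neg, abs_of_pos (by positivity : (0 : ℝ) < s * b ^ n)]
    calc _ ≤ 4 * (b : ℝ) / (s * b ^ n) := by gcongr
      _ ≤ 4 * b / (1 * b ^ n) := by gcongr
      _ = _ := by rw [one_mul]
  have hβ : R / 2 ≤ ((b ^ k * r : ℕ) : ℝ) / s := by
    have h2 : (b : ℝ) ≤ b ^ k := by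
      simpa using pow_le_pow_right₀ (by linarith : (1 : ℝ) ≤ b) hk
    rw [le_div_iff₀ (by linarith)]
    push_cast
    nlinarith [mul_le_mul_of_nonneg_left hs' hR0.le, mul_le_mul h2 hr0 zero_le_one (by positivity)]
  have h4 : 4 * (b : ℝ) / b ^ n ≤ 4 := by
    rw [div_le_iff₀ (by positivity)]
    have : (b : ℝ) ≤ b ^ n := by
      simpa using pow_le_pow_right₀ (by linarith : (1 : ℝ) ≤ b) hn
    linarith
  have h5 := abs_le.1 (hclose.trans h4)
  have h6 : R / 4 ≤ ((c : ℝ) / b) ^ n := by linarith [h5.1]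
  refine ⟨hlam0, hlam, hclose, by linarith, ?_⟩
  have h7 := Real.log_le_log (by positivity) h6
  rw [Real.log_pow, Real.log_div hR0.ne' (by norm_num), show (4 : ℝ) = 2 ^ 2 by norm_num,
    Real.log_pow, hR, Real.log_sqrt hb0.le] at h7
  have h8 := Real.log_le_log (by positivity) hbR
  rw [Real.log_pow] at h8
  push_cast at h7 h8
  have h9 : 23 / 48 * Real.log b ≤ n * Real.log ((c : ℝ) / b) := by linarith
  have h10 : (n : ℝ) * (Real.log ((c : ℝ) / b) * R) ≤ n * 2 := by gcongr
  nlinarith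

theorem log_sqrt_bounds_of_two_pow_le {b : ℕ} (hb : 2 ^ 96 ≤ b) :
    96 * Real.log 2 ≤ Real.log b ∧ 64 ≤ Real.log b ∧ (2 : ℝ) ^ 48 ≤ √(b : ℝ) ∧
      Real.log (√(b : ℝ)) = Real.log b / 2 := by
  have hbR : (2 : ℝ) ^ 96 ≤ b := by exact_mod_cast hb
  have h8 := Real.log_le_log (by positivity) hbR
  rw [Real.log_pow] at h8
  push_cast at h8
  refine ⟨h8, by linarith [Real.log_two_gt_d9], Real.le_sqrt_of_sq_le ?_, Real.log_sqrt (by positivity)⟩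
  norm_num at hbR ⊢
  exact hbR

theorem log_le_and_mul_log_le {b n Q : ℕ} {lam : ℝ} (hb : 2 ^ 96 ≤ b) (hnu : n ≤ 2 ^ 27 * Q)
    (hlam0 : 0 < lam) (hlam : lam * √(b : ℝ) ≤ 2)
    (hnl : 23 * (Real.log b * √(b : ℝ)) ≤ 96 * n) :
    32768 * Real.log b ≤ Q / 8 ∧ 32768 * (n * lam) ≤ Q / 32 := by
  obtain ⟨-, hl, hR, -⟩ := log_sqrt_bounds_of_two_pow_le hb
  have hnu' : (n : ℝ) ≤ 2 ^ 27 * Q := by exact_mod_cast hnu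
  constructor
  · have h1 : Real.log b * 2 ^ 48 ≤ Real.log b * √(b : ℝ) := by gcongr
    norm_num at h1 hnu' ⊢
    linarith
  · have h1 : (n * lam) * 2 ^ 48 ≤ (n * lam) * √(b : ℝ) := by gcongr
    have h2 : (n : ℝ) * (lam * √(b : ℝ)) ≤ n * 2 := by gcongr
    norm_num at h1 hnu' ⊢
    linarith

/-- Bound for the polynomial factor at the nodes. -/
theorem eval_risePoly_le_exp {b n Q u : ℕ} {x : ℝ} (hb : 2 ^ 96 ≤ b)
    (hnu : n ≤ 2 ^ 27 * Q) (hu : u < 2048 * Q) (hx : 0 ≤ x) (hxn : x + u ≤ 1024 * n) :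
    (risePoly u).eval x ≤ Real.exp (587 * (Q * Real.log b)) := by
  obtain ⟨h2, hl, -, -⟩ := log_sqrt_bounds_of_two_pow_le hb
  have hnu' : (n : ℝ) ≤ 2 ^ 27 * Q := by exact_mod_cast hnu
  refine (eval_risePoly_le hu.le hx (y := 2 ^ 26) (by norm_num) ?_).trans ?_
  · push_cast
    linarith
  · rw [show (2 : ℝ) ^ 26 = Real.exp (26 * Real.log 2) by
      rw [mul_comm, Real.exp_mul, Real.exp_log two_pos]; norm_cast, ← Real.exp_add,
      ← Real.exp_nat_mul]
    refine Real.exp_le_exp.2 ?_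
    push_cast
    have h3 : (Q : ℝ) * (2048 * (1 + 26 * Real.log 2)) ≤ Q * (587 * Real.log b) :=
      mul_le_mul_of_nonneg_left (by linarith) (Nat.cast_nonneg _)
    linarith

/-- Bound for the polynomial factor after differentiation. -/
theorem eval_risePoly_add_le_exp {b n Q S u : ℕ} {x : ℝ} (hb : 2 ^ 96 ≤ b)
    (hnu : n ≤ 2 ^ 27 * Q) (hu : u < 2048 * Q) (hS : S ≤ 65536 * Q) (hx : 0 ≤ x)
    (hxn : x ≤ 1024 * n) :
    (risePoly u).eval (x + (S * 1024 : ℕ) / (64 / √(b : ℝ))) ≤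
      Real.exp (1270 * (Q * Real.log b)) := by
  obtain ⟨h2, hl, hR, hlR⟩ := log_sqrt_bounds_of_two_pow_le hb
  have hnu' : (n : ℝ) ≤ 2 ^ 27 * Q := by exact_mod_cast hnu
  have hu' : (u : ℝ) ≤ 2048 * Q := by exact_mod_cast hu.le
  have hS' : (S : ℝ) ≤ 65536 * Q := by exact_mod_cast hS
  set R := √(b : ℝ) with hRdef
  have hR0 : 0 < R := lt_of_lt_of_le (by positivity) hR
  refine (eval_risePoly_le hu.le (by positivity) (y := 2 ^ 10 * R) (by linarith) ?_).trans ?_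
  · push_cast
    have e1 : (S : ℝ) * 1024 / (64 / R) = S * (16 * R) := by field_simp; ring
    have e2 : (S : ℝ) * (16 * R) ≤ 65536 * Q * (16 * R) := by gcongr
    have e3 : (Q : ℝ) * 2 ^ 48 ≤ Q * R := by gcongr
    rw [e1]
    norm_num at e2 e3 hnu' ⊢
    linarith
  · rw [show (2 : ℝ) ^ 10 * R = Real.exp (10 * Real.log 2 + Real.log b / 2) by
      rw [Real.exp_add, ← hlR, Real.exp_log hR0, mul_comm 10, Real.exp_mul, Real.exp_log two_pos]
      norm_cast, ← Real.exp_add, ← Real.exp_nat_mul]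
    refine Real.exp_le_exp.2 ?_
    push_cast
    have h3 : (Q : ℝ) * (2048 * (1 + (10 * Real.log 2 + Real.log b / 2))) ≤
        Q * (1270 * Real.log b) :=
      mul_le_mul_of_nonneg_left (by linarith) (Nat.cast_nonneg _)
    linarith

/-- Bound for the effect of replacing `α ^ n` by `β`. -/
theorem pow_mul_abs_pow_sub_pow_le {α β δ lam : ℝ} {n Q S v i j : ℕ} (hα : α = Real.exp lam)
    (hlam : 0 ≤ lam) (hnlam : 32768 * (n * lam) ≤ Q / 32) (hQ : 10 ^ 6 ≤ Q) (hβ0 : 0 ≤ β)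
    (hβ : β ≤ 2 * α ^ n) (hδ : |α ^ n - β| ≤ δ) (hSn : S ≤ n) (hv : v < 32) (hi : i ≤ S)
    (hj : j < 1024) :
    α ^ (v * i) * |(α ^ n) ^ (v * j) - β ^ (v * j)| ≤ Real.exp (3 * Q) * δ := by
  have hQ' : (10 : ℝ) ^ 6 ≤ Q := by exact_mod_cast hQ
  have hα1 : 1 ≤ α := by rw [hα]; exact Real.one_le_exp hlam
  have hm : v * j ≤ 32768 := by nlinarith
  have h1 : α ^ (v * i) ≤ Real.exp Q := by
    have e1 : v * i ≤ 32768 * n := by nlinarith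
    refine (pow_le_pow_right₀ hα1 e1).trans ?_
    rw [hα, ← Real.exp_nat_mul]
    refine Real.exp_le_exp.2 ?_
    push_cast
    linarith
  have hA1 : 1 ≤ 2 * α ^ n := by linarith [one_le_pow₀ hα1 (n := n)]
  have h2 : |(α ^ n) ^ (v * j) - β ^ (v * j)| ≤ δ * (32768 * (2 * α ^ n) ^ 32768) := by
    refine (abs_pow_sub_pow_le _ _ _).trans ?_
    rw [mul_assoc]
    refine mul_le_mul hδ ?_ (by positivity) ((abs_nonneg _).trans hδ)
    have e2 : max |α ^ n| |β| ≤ 2 * α ^ n := by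
      rw [abs_of_nonneg (by positivity), abs_of_nonneg hβ0]
      exact max_le (by linarith) hβ
    refine mul_le_mul (by exact_mod_cast hm) ?_ (by positivity) (by positivity)
    exact (pow_le_pow_left₀ (by positivity) e2 _).trans (pow_le_pow_right₀ hA1 (by omega))
  have h3 : (32768 : ℝ) ≤ Real.exp Q := by linarith [Real.add_one_le_exp (Q : ℝ)]
  have h4 : (2 * α ^ n) ^ 32768 ≤ Real.exp Q := by
    have e3 : (2 : ℝ) ≤ Real.exp 1 := Real.exp_one_gt_two.le
    calc (2 * α ^ n) ^ 32768 ≤ (Real.exp 1 * α ^ n) ^ 32768 := by gcongr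
      _ = Real.exp (32768 * (1 + n * lam)) := by
        rw [hα, ← Real.exp_nat_mul, ← Real.exp_add, ← Real.exp_nat_mul]
        norm_num
      _ ≤ _ := Real.exp_le_exp.2 (by linarith)
  have hδ0 : 0 ≤ δ := (abs_nonneg _).trans hδ
  calc _ ≤ Real.exp Q * (δ * (Real.exp Q * Real.exp Q)) := by
        refine mul_le_mul h1 (h2.trans ?_) (abs_nonneg _) (Real.exp_pos _).le
        gcongr
    _ = _ := by
        rw [show (3 * Q : ℝ) = Q + (Q + Q) by ring, Real.exp_add, Real.exp_add]
        ring

theorem natCast_mul_le_exp {Q : ℕ} (hQ : 10 ^ 6 ≤ Q) {m : ℝ} (hm : m ≤ 2 ^ 27) :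
    m * (Q + 1) ≤ Real.exp (2 * Q) := by
  have hQ' : (10 : ℝ) ^ 6 ≤ Q := by exact_mod_cast hQ
  have h1 := Real.quadratic_le_exp_of_nonneg (x := (Q : ℝ)) (by positivity)
  have h2 := Real.add_one_le_exp (Q : ℝ)
  have h3 : (2 : ℝ) ^ 27 ≤ Real.exp Q := by nlinarith
  rw [two_mul, Real.exp_add]
  exact mul_le_mul (hm.trans h3) h2 (by positivity) (Real.exp_pos _).le

/-- The interpolation remainder is small compared with the denominators. -/
theorem main_term_lt {b n Q S : ℕ} {D : ℝ} (hb : 2 ^ 96 ≤ b) (hQ : 10 ^ 6 ≤ Q)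
    (hnu : n ≤ 2 ^ 27 * Q) (hS1 : 32 * Q ≤ S) (hD0 : 0 ≤ D)
    (hD : D ≤ Real.exp (32 * (S * Real.log b) + Q)) :
    ((2048 * Q : ℕ) : ℝ) * (32 : ℕ) * (Real.exp (1622 * (Q * Real.log b)) *
      ((64 / √(b : ℝ)) ^ (S * 1024) * Real.exp (1270 * (Q * Real.log b)) * Real.exp Q)) /
        (S * 1024).factorial * ((1024 : ℕ) * n : ℝ) ^ (S * 1024) * D < 1 / 2 := by
  obtain ⟨h2, hl, hR, hlR⟩ := log_sqrt_bounds_of_two_pow_le hb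
  have hQ' : (10 : ℝ) ^ 6 ≤ Q := by exact_mod_cast hQ
  have hnu' : (n : ℝ) ≤ 2 ^ 27 * Q := by exact_mod_cast hnu
  have hS1' : (32 * Q : ℝ) ≤ S := by exact_mod_cast hS1
  set R := √(b : ℝ) with hRdef
  have hR0 : 0 < R := lt_of_lt_of_le (by positivity) hR
  set ℓ := Real.log b
  have hmain : (64 / R * ((1024 : ℕ) * n)) ^ (S * 1024) / (S * 1024).factorial ≤
      Real.exp (1024 * S * (1 + (28 * Real.log 2 - ℓ / 2))) := by
    refine (pow_div_factorial_le_exp_mul (t := R / 2 ^ 28) (by positivity) (by positivity)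
      ?_).trans ?_
    · push_cast
      rw [show R / 2 ^ 28 * (64 / R * (1024 * (n : ℝ))) = n / 2 ^ 12 by field_simp; norm_num]
      norm_num at hnu' ⊢
      linarith
    · rw [inv_div, show (2 : ℝ) ^ 28 / R = Real.exp (28 * Real.log 2 - ℓ / 2) by
        rw [Real.exp_sub, ← hlR, Real.exp_log hR0, mul_comm 28, Real.exp_mul, Real.exp_log two_pos]
        norm_cast, ← Real.exp_nat_mul, ← Real.exp_add]
      refine Real.exp_le_exp.2 (le_of_eq ?_)
      push_cast
      ring
  have hKL : ((2048 * Q : ℕ) : ℝ) * (32 : ℕ) ≤ Real.exp (2 * Q) := by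
    have := natCast_mul_le_exp hQ (m := 65536) (by norm_num)
    push_cast
    linarith
  calc
    _ = ((2048 * Q : ℕ) : ℝ) * (32 : ℕ) * (Real.exp (1622 * (Q * ℓ)) *
        Real.exp (1270 * (Q * ℓ)) * Real.exp Q) *
          ((64 / R * ((1024 : ℕ) * n)) ^ (S * 1024) / (S * 1024).factorial) * D := by
        rw [mul_pow (64 / R)]
        ring
    _ ≤ Real.exp (2 * Q) * (Real.exp (1622 * (Q * ℓ)) *
        Real.exp (1270 * (Q * ℓ)) * Real.exp Q) *
          Real.exp (1024 * S * (1 + (28 * Real.log 2 - ℓ / 2))) *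
            Real.exp (32 * (S * ℓ) + Q) := by
        gcongr
    _ ≤ Real.exp (-1) := by
        simp only [← Real.exp_add]
        refine Real.exp_le_exp.2 ?_
        have e1 : (S : ℝ) * (1024 * (1 + (28 * Real.log 2 - ℓ / 2)) + 32 * ℓ) ≤
            32 * Q * (1024 * (1 + (28 * Real.log 2 - ℓ / 2)) + 32 * ℓ) :=
          mul_le_mul_of_nonpos_right hS1' (by linarith)
        have e2 : (Q : ℝ) * (32 * (1024 * (1 + (28 * Real.log 2 - ℓ / 2)) + 32 * ℓ) + 2892 * ℓ + 5)
            ≤ Q * (-1) := mul_le_mul_of_nonneg_left (by linarith) (by positivity)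
        linarith
    _ < _ := Real.exp_neg_one_lt_half

/-- The contribution of replacing `α ^ n` by `β` is small compared with the denominators. -/
theorem perturbation_term_lt {b n Q S : ℕ} {D : ℝ} (hb : 2 ^ 96 ≤ b) (hQ : 10 ^ 6 ≤ Q)
    (hnl : 2 ^ 26 * Q ≤ n) (hS2 : S ≤ 65536 * Q) (hD0 : 0 ≤ D)
    (hD : D ≤ Real.exp (32 * (S * Real.log b) + Q)) :
    ((2048 * Q : ℕ) : ℝ) * (32 : ℕ) * (Real.exp (1622 * (Q * Real.log b)) *
      (Real.exp (587 * (Q * Real.log b)) * (Real.exp (3 * Q) * (4 * b / (b : ℝ) ^ n)))) *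
        (1 + (S * 1024 : ℕ) * ((2 * (1024 : ℕ) : ℝ) ^ (S * 1024) *
          ((2 * ((1024 : ℕ) : ℝ) ^ 2) ^ S * Real.exp (n / (1024 : ℕ))))) * D < 1 / 2 := by
  obtain ⟨h2, hl, hR, hlR⟩ := log_sqrt_bounds_of_two_pow_le hb
  have hb0 : (0 : ℝ) < b := by exact_mod_cast (by omega : 0 < b)
  have hQ' : (10 : ℝ) ^ 6 ≤ Q := by exact_mod_cast hQ
  have hnl' : (2 ^ 26 * Q : ℝ) ≤ n := by exact_mod_cast hnl
  have hS2' : (S : ℝ) ≤ 65536 * Q := by exact_mod_cast hS2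
  have hlog2 := Real.log_pos one_lt_two
  have hbe : (b : ℝ) = Real.exp (Real.log b) := (Real.exp_log hb0).symm
  set ℓ := Real.log b
  have h2e : (2 : ℝ) = Real.exp (Real.log 2) := (Real.exp_log two_pos).symm
  have hKL : ((2048 * Q : ℕ) : ℝ) * (32 : ℕ) ≤ Real.exp (2 * Q) := by
    have := natCast_mul_le_exp hQ (m := 65536) (by norm_num)
    push_cast
    linarith
  have hη : 4 * b / (b : ℝ) ^ n = Real.exp (2 * Real.log 2 + ℓ - n * ℓ) := by
    rw [Real.exp_sub, Real.exp_add, Real.exp_nat_mul, ← hbe, mul_comm 2 (Real.log 2), Real.exp_mul,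
      ← h2e]
    norm_num
  have hG : (2 * (1024 : ℕ) : ℝ) ^ (S * 1024) *
      ((2 * ((1024 : ℕ) : ℝ) ^ 2) ^ S * Real.exp (n / (1024 : ℕ))) =
        Real.exp (11285 * (S * Real.log 2) + n / 1024) := by
    rw [show (2 * (1024 : ℕ) : ℝ) = 2 ^ 11 by norm_num,
      show (2 * ((1024 : ℕ) : ℝ) ^ 2) = 2 ^ 21 by norm_num, ← pow_mul, ← pow_mul, ← mul_assoc,
      ← pow_add, Real.exp_add]
    congr 1
    · rw [h2e, ← Real.exp_nat_mul, ← h2e]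
      push_cast
      ring_nf
  rw [hη, hG]
  set g := Real.exp (11285 * (S * Real.log 2) + n / 1024) with hg
  have hg1 : 1 ≤ g := Real.one_le_exp (by positivity)
  have hNG : 1 + (S * 1024 : ℕ) * g ≤ Real.exp (2 * Q) * g := by
    have h3 := natCast_mul_le_exp hQ (m := 2 ^ 26) (by norm_num)
    have h4 : 1 + ((S * 1024 : ℕ) : ℝ) ≤ Real.exp (2 * Q) := by
      push_cast
      linarith
    nlinarith
  calc
    _ ≤ Real.exp (2 * Q) * (Real.exp (1622 * (Q * ℓ)) *
      (Real.exp (587 * (Q * ℓ)) * (Real.exp (3 * Q) * Real.exp (2 * Real.log 2 + ℓ - n * ℓ)))) *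
        (Real.exp (2 * Q) * g) * Real.exp (32 * (S * ℓ) + Q) := by
        gcongr
    _ ≤ Real.exp (-1) := by
        rw [hg]
        simp only [← Real.exp_add]
        refine Real.exp_le_exp.2 ?_
        have e1 : (S : ℝ) * (11285 * Real.log 2 + 32 * ℓ) ≤
            65536 * Q * (11285 * Real.log 2 + 32 * ℓ) :=
          mul_le_mul_of_nonneg_right hS2' (by linarith)
        have e2 : (n : ℝ) * (1 / 1024 - ℓ) ≤ 2 ^ 26 * Q * (1 / 1024 - ℓ) :=
          mul_le_mul_of_nonpos_right hnl' (by linarith)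
        have e3 : (Q : ℝ) * (65536 * (11285 * Real.log 2 + 32 * ℓ) + 2 ^ 26 * (1 / 1024 - ℓ) +
            2209 * ℓ + 8) ≤ Q * (-ℓ) := mul_le_mul_of_nonneg_left (by linarith) (by positivity)
        have e4 : (10 : ℝ) ^ 6 * ℓ ≤ Q * ℓ := by gcongr
        linarith
    _ < _ := Real.exp_neg_one_lt_half

/-- Vanishing on the first `S` translates of the nodes propagates to the next one. -/
theorem auxVal_eq_zero_of_vanish {b c B s n Q S : ℕ} {p : Fin (2048 * Q) × Fin 32 → ℤ}
    (hb : 2 ^ 96 ≤ b) (hs : 1 ≤ s) (hsb : s ≤ b) (hQ : 10 ^ 6 ≤ Q) (hnl : 2 ^ 26 * Q ≤ n)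
    (hnu : n ≤ 2 ^ 27 * Q) (hlam0 : 0 < Real.log ((c : ℝ) / b))
    (hlam : Real.log ((c : ℝ) / b) * √(b : ℝ) ≤ 2) (hα0 : 0 < (c : ℝ) / b)
    (hclose : |((c : ℝ) / b) ^ n - (B : ℝ) / s| ≤ 4 * b / (b : ℝ) ^ n)
    (hβ : (B : ℝ) / s ≤ 2 * ((c : ℝ) / b) ^ n)
    (hlog : 23 * (Real.log b * √(b : ℝ)) ≤ 96 * n)
    (hp : ∀ w, |(p w : ℝ)| ≤ Real.exp (1622 * (Q * Real.log b)))
    (hS1 : 32 * Q ≤ S) (hS2 : S ≤ 65536 * Q)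
    (hV : ∀ i < S, ∀ j < 1024, auxVal p ((c : ℝ) / b) ((B : ℝ) / s) n i j = 0)
    {j : ℕ} (hj : j < 1024) : auxVal p ((c : ℝ) / b) ((B : ℝ) / s) n S j = 0 := by
  obtain ⟨h2, hl, hR, hlR⟩ := log_sqrt_bounds_of_two_pow_le hb
  obtain ⟨hLl, hLn⟩ := log_le_and_mul_log_le hb hnu hlam0 hlam hlog
  have hR0 : 0 < √(b : ℝ) := lt_of_lt_of_le (by positivity) hR
  have hb0 : (0 : ℝ) < b := by exact_mod_cast (by omega : 0 < b)
  have hs0 : (0 : ℝ) < s := by exact_mod_cast hs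
  have hsb' : (s : ℝ) ≤ b := by exact_mod_cast hsb
  have hSn : S * 2 ≤ n := by omega
  have hSn' : (S : ℝ) * 2 ≤ n := by exact_mod_cast hSn
  have hnl' : (2 ^ 26 * Q : ℝ) ≤ n := by exact_mod_cast hnl
  set lam := Real.log ((c : ℝ) / b) with hlamdef
  have key := abs_auxVal_le_of_vanish (Real.exp_pos _).le hp (Real.exp_log hα0).symm hlam0.le
    (σ := 64 / √(b : ℝ)) (by positivity)
    (by rw [le_div_iff₀ hR0]; push_cast; linarith) (n := n) (S := S) (J := 1024) (by omega)
    (by omega) (P₁ := Real.exp (587 * (Q * Real.log b)))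
    (E₁ := Real.exp (3 * Q) * (4 * b / (b : ℝ) ^ n))
    (P₂ := Real.exp (1270 * (Q * Real.log b))) (E₂ := Real.exp Q)
    (fun u hu i hi j hj => eval_risePoly_le_exp hb hnu hu (by positivity) (by
      have e1 : (i : ℝ) ≤ S := by exact_mod_cast hi
      have e2 : (u : ℝ) ≤ 2048 * Q := by exact_mod_cast hu.le
      have e3 : ((j : ℝ) + 1) * n ≤ 1024 * n := by
        gcongr
        exact_mod_cast hj
      norm_num at hnl'
      linarith))
    (fun v hv i hi j hj => pow_mul_abs_pow_sub_pow_le (Real.exp_log hα0).symm hlam0.le hLn hQ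
      (by positivity) hβ hclose (by omega : S ≤ n) hv hi hj)
    (fun u hu x hx hxn => eval_risePoly_add_le_exp hb hnu hu hS2 hx (by exact_mod_cast hxn))
    (Real.exp_le_exp.2 (by push_cast; linarith [Nat.cast_nonneg (α := ℝ) Q])) hV hj
  have hD0 : 0 < (b : ℝ) ^ (32 * S) * (s : ℝ) ^ (32 * j) := by positivity
  have hD : (b : ℝ) ^ (32 * S) * (s : ℝ) ^ (32 * j) ≤ Real.exp (32 * (S * Real.log b) + Q) := by
    have e1 : (b : ℝ) ^ (32 * S) = Real.exp (32 * (S * Real.log b)) := by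
      nth_rw 1 [← Real.exp_log hb0]
      rw [← Real.exp_nat_mul]
      push_cast
      ring_nf
    have e2 : (s : ℝ) ^ (32 * j) ≤ Real.exp Q := by
      have h1b : (1 : ℝ) ≤ b := by exact_mod_cast hs.trans hsb
      calc (s : ℝ) ^ (32 * j) ≤ (b : ℝ) ^ (32 * j) := by gcongr
        _ ≤ (b : ℝ) ^ 32768 := pow_le_pow_right₀ h1b (by omega)
        _ = Real.exp (32768 * Real.log b) := by
          nth_rw 1 [← Real.exp_log hb0]
          rw [← Real.exp_nat_mul]
          norm_num
        _ ≤ _ := Real.exp_le_exp.2 (by linarith [Nat.cast_nonneg (α := ℝ) Q])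
    rw [Real.exp_add, e1]
    gcongr
  refine auxVal_eq_zero_of_abs_lt p (by omega) hs n S j ?_
  have m1 := main_term_lt hb hQ hnu hS1 hD0.le hD
  have m2 := perturbation_term_lt hb hQ hnl hS2 hD0.le hD
  refine lt_of_le_of_lt (mul_le_mul_of_nonneg_right key hD0.le) ?_
  rw [add_mul]
  linarith

/-- Existence of a small nonzero coefficient vector with prescribed zeros. -/
theorem exists_auxVal_eq_zero {b c B s n Q : ℕ}
    (hb : 2 ^ 96 ≤ b) (hbc : b < c) (hB : 1 ≤ B) (hs : 1 ≤ s) (hsb : s ≤ b) (hQ : 10 ^ 6 ≤ Q)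
    (hnl : 2 ^ 26 * Q ≤ n)
    (hnu : n ≤ 2 ^ 27 * Q) (hlam0 : 0 < Real.log ((c : ℝ) / b))
    (hlam : Real.log ((c : ℝ) / b) * √(b : ℝ) ≤ 2)
    (hβ : (B : ℝ) / s ≤ 2 * ((c : ℝ) / b) ^ n)
    (hlog : 23 * (Real.log b * √(b : ℝ)) ≤ 96 * n) :
    ∃ p : Fin (2048 * Q) × Fin 32 → ℤ, p ≠ 0 ∧
      (∀ w, |(p w : ℝ)| ≤ Real.exp (1622 * (Q * Real.log b))) ∧
      ∀ i < 32 * Q, ∀ j < 1024, auxVal p ((c : ℝ) / b) ((B : ℝ) / s) n i j = 0 := by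
  obtain ⟨h2, hl, hR, hlR⟩ := log_sqrt_bounds_of_two_pow_le hb
  obtain ⟨hLl, hLn⟩ := log_le_and_mul_log_le hb hnu hlam0 hlam hlog
  have hQ' : (10 : ℝ) ^ 6 ≤ Q := by exact_mod_cast hQ
  have hb0 : (0 : ℝ) < b := by exact_mod_cast (by omega : 0 < b)
  have hc0 : (0 : ℝ) < c := by exact_mod_cast (by omega : 0 < c)
  have hs0 : (0 : ℝ) < s := by exact_mod_cast hs
  have hsb' : (s : ℝ) ≤ b := by exact_mod_cast hsb
  have hnl' : (2 ^ 26 * Q : ℝ) ≤ n := by exact_mod_cast hnl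
  have hlam2 : Real.log ((c : ℝ) / b) ≤ 1 / 2 := by
    have : Real.log ((c : ℝ) / b) * 2 ^ 48 ≤ Real.log ((c : ℝ) / b) * √(b : ℝ) := by gcongr
    norm_num at this
    linarith
  have hn0 : (0 : ℝ) ≤ n * Real.log ((c : ℝ) / b) := by positivity
  have hc : (c : ℝ) ^ (1024 * Q) ≤ Real.exp (1024 * (Q * Real.log b) + Q * 512) := by
    have e1 : (c : ℝ) = Real.exp (Real.log b + Real.log ((c : ℝ) / b)) := by
      rw [Real.exp_add, Real.exp_log hb0, Real.exp_log (by positivity)]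
      field_simp
    nth_rw 1 [e1]
    rw [← Real.exp_nat_mul]
    refine Real.exp_le_exp.2 ?_
    push_cast
    have : (Q : ℝ) * Real.log ((c : ℝ) / b) ≤ Q * (1 / 2) := by gcongr
    linarith
  have hsp : (s : ℝ) ^ 32768 ≤ Real.exp Q := by
    calc (s : ℝ) ^ 32768 ≤ (Real.exp (Real.log b)) ^ 32768 := by
          rw [Real.exp_log hb0]; gcongr
      _ ≤ _ := by
          rw [← Real.exp_nat_mul]
          exact Real.exp_le_exp.2 (by push_cast; linarith)
  have hBp : (B : ℝ) ^ 32768 ≤ Real.exp Q := by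
    have e2 : (B : ℝ) ≤ Real.exp (1 + n * Real.log ((c : ℝ) / b) + Real.log b) := by
      rw [Real.exp_add, Real.exp_add, Real.exp_nat_mul, Real.exp_log (by positivity),
        Real.exp_log hb0]
      rw [div_le_iff₀ hs0] at hβ
      refine hβ.trans ?_
      have := Real.exp_one_gt_two.le
      gcongr
    refine (pow_le_pow_left₀ (by positivity) e2 _).trans ?_
    rw [← Real.exp_nat_mul]
    exact Real.exp_le_exp.2 (by push_cast; linarith)
  set M := Real.exp (1611 * (Q * Real.log b) + Q * 514) with hM
  obtain ⟨p, hp0, hp, hle⟩ := exists_ne_zero_mulVec_eq_zero_abs_le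
    (ι := Fin (32 * Q) × Fin 1024) (κ := Fin (2048 * Q) × Fin 32)
    (Matrix.of fun q w => ((((q.1 : ℕ) + q.2 * n + w.1).choose w.1 *
        (c ^ ((w.2 : ℕ) * q.1) * b ^ ((32 - (w.2 : ℕ)) * q.1) *
          (B ^ ((w.2 : ℕ) * q.2) * s ^ ((32 - (w.2 : ℕ)) * q.2))) : ℕ) : ℤ))
    (by simp; omega) (by simp; omega) (M := M) (Real.one_le_exp (by positivity)) (by
      rintro ⟨i, j⟩ ⟨u, v⟩
      rw [Matrix.of_apply, Int.cast_natCast, Nat.abs_cast]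
      push_cast
      have hvi : (v : ℕ) * i + (32 - v) * i = 32 * i := by
        rw [← add_mul]; congr 1; omega
      have e1 : ((((i : ℕ) + j * n + u).choose u : ℕ) : ℝ) ≤ Real.exp (587 * (Q * Real.log b)) := by
        rw [← eval_risePoly_natCast]
        refine eval_risePoly_le_exp hb hnu u.2 (by positivity) ?_
        have : (i : ℕ) + j * n + u ≤ 1024 * n := by
          have := i.2
          have := u.2
          have : ((j : ℕ) + 1) * n ≤ 1024 * n := Nat.mul_le_mul_right _ j.2
          linarith
        exact_mod_cast this
      have e2 : (c : ℝ) ^ ((v : ℕ) * i) * (b : ℝ) ^ ((32 - v) * (i : ℕ)) ≤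
          Real.exp (1024 * (Q * Real.log b) + Q * 512) := by
        refine le_trans ?_ hc
        calc _ ≤ (c : ℝ) ^ ((v : ℕ) * i) * (c : ℝ) ^ ((32 - v) * (i : ℕ)) := by
              gcongr
          _ = (c : ℝ) ^ (32 * (i : ℕ)) := by rw [← pow_add, hvi]
          _ ≤ _ := pow_le_pow_right₀ (by exact_mod_cast (by omega : 1 ≤ c)) (by have := i.2; omega)
      have e3 : (B : ℝ) ^ ((v : ℕ) * j) ≤ Real.exp Q :=
        (pow_le_pow_right₀ (by exact_mod_cast hB)
          ((Nat.mul_le_mul v.2.le j.2.le).trans (by norm_num))).trans hBp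
      have e4 : (s : ℝ) ^ ((32 - v) * (j : ℕ)) ≤ Real.exp Q :=
        (pow_le_pow_right₀ (by exact_mod_cast hs)
          ((Nat.mul_le_mul (Nat.sub_le _ _) j.2.le).trans (by norm_num))).trans hsp
      calc _ ≤ Real.exp (587 * (Q * Real.log b)) *
            (Real.exp (1024 * (Q * Real.log b) + Q * 512) * (Real.exp Q * Real.exp Q)) := by
            gcongr
        _ = M := by
            rw [hM]
            simp only [← Real.exp_add]
            ring_nf)
  refine ⟨p, hp0, fun w => (hle w).trans ?_, fun i hi j hj => ?_⟩
  · have hKL := natCast_mul_le_exp hQ (m := 65536) (by norm_num)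
    have h5 : ((Fintype.card (Fin (2048 * Q) × Fin 32) : ℕ) : ℝ) ≤ Real.exp (2 * Q) := by
      simp only [Fintype.card_prod, Fintype.card_fin]
      push_cast
      linarith
    calc _ ≤ Real.exp (2 * Q) * M := by gcongr
      _ ≤ _ := by
        rw [hM, ← Real.exp_add]
        refine Real.exp_le_exp.2 ?_
        have : (Q : ℝ) * 64 ≤ Q * Real.log b := by gcongr
        linarith
  · have h6 := auxVal_mul_eq p (by omega : 0 < b) hs n i j (c := c) (B := B)
    have h7 := congrFun hp (⟨i, hi⟩, ⟨j, hj⟩)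
    simp only [Matrix.mulVec, dotProduct, Matrix.of_apply, Pi.zero_apply] at h7
    rw [h7, Int.cast_zero] at h6
    exact (mul_eq_zero.1 h6).resolve_right (by positivity)

/-- The numbers `r b ^ (n + k)` and `s c ^ n` cannot be close to each other. -/
theorem not_abs_sub_le {b c r s k n : ℕ} (hb : 2 ^ 96 ≤ b) (hbc : b < c)
    (hδ : ((c : ℝ) - b) ^ 2 ≤ 4 * b) (hr : 1 ≤ r) (hs : 1 ≤ s) (hs2 : (s : ℝ) ^ 2 ≤ 4 * b)
    (hk : 1 ≤ k) (hn : 1 ≤ n) : ¬ |(r : ℝ) * b ^ (n + k) - s * c ^ n| ≤ 4 * b := by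
  intro h
  obtain ⟨hlam0, hlam, hclose, hβ, hlog⟩ := size_of_close hb hbc hδ hr hs hs2 hk hn h
  obtain ⟨-, hl, hR, -⟩ := log_sqrt_bounds_of_two_pow_le hb
  have hn1 : 10 ^ 15 ≤ n := by
    have h1 : (64 : ℝ) * 2 ^ 48 ≤ Real.log b * √(b : ℝ) := by gcongr
    have h2 : (10 : ℝ) ^ 15 ≤ n := by
      norm_num at h1
      linarith
    exact_mod_cast h2
  have hα1 : 1 < (c : ℝ) / b := (one_lt_div (by exact_mod_cast (by omega : 0 < b))).2
    (by exact_mod_cast hbc)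
  have hsb : s ≤ b := by
    have h3 : s ^ 2 ≤ 4 * b := by exact_mod_cast hs2
    nlinarith
  have hB : 1 ≤ b ^ k * r := Nat.mul_pos (pow_pos (by omega) _) hr
  set Q := n / 2 ^ 26 with hQdef
  have hQ : 10 ^ 6 ≤ Q := by omega
  have hnl : 2 ^ 26 * Q ≤ n := by omega
  have hnu : n ≤ 2 ^ 27 * Q := by omega
  obtain ⟨p, hp0, hp, hV⟩ := exists_auxVal_eq_zero hb hbc hB hs hsb hQ hnl hnu hlam0 hlam hβ hlog
  have hall : ∀ S, 32 * Q ≤ S → S ≤ 65536 * Q → ∀ i < S, ∀ j < 1024,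
      auxVal p ((c : ℝ) / b) (((b ^ k * r : ℕ) : ℝ) / s) n i j = 0 := by
    intro S hS
    induction S, hS using Nat.le_induction with
    | base => exact fun _ => hV
    | succ S hS ih =>
      intro hS2 i hi j hj
      have ih' := ih (by omega)
      rcases Nat.lt_succ_iff_lt_or_eq.1 hi with hi | rfl
      · exact ih' i hi j hj
      · exact auxVal_eq_zero_of_vanish hb hs hsb hQ hnl hnu hlam0 hlam (by positivity) hclose hβ
          hlog hp hS (by omega) ih' hj
  exact hp0 (eq_zero_of_auxVal_eq_zero p hα1 n fun i hi =>
    hall (65536 * Q) (by omega) le_rfl i (by omega) 0 (by norm_num))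

end ExponentialPolynomials

/-- `x` is the value of the infinite continued fraction `[0; a 0, a 1, …]`. -/
def HasContFrac (a : ℕ → ℕ) (x : ℝ) : Prop :=
  (∀ i, 0 < a i) ∧ Tendsto (fun n => cfVal ((List.range n).map a)) atTop (𝓝 x)

theorem cfVal_mem_Icc (l : List ℕ) (hl : ∀ h ∈ l, 0 < h) : cfVal l ∈ Set.Icc (0 : ℝ) 1 := by
  induction l with
  | nil => simp [cfVal]
  | cons h t ih =>
    have h1 := ih fun k hk => hl k (List.mem_cons_of_mem _ hk)
    have h2 : (1 : ℝ) ≤ h := by exact_mod_cast hl h List.mem_cons_self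
    have h3 : (1 : ℝ) ≤ h + cfVal t := by linarith [h1.1]
    rw [cfVal]
    exact ⟨by positivity, (div_le_one (by linarith)).2 h3⟩

theorem cfVal_range_succ (a : ℕ → ℕ) (n : ℕ) :
    cfVal ((List.range (n + 1)).map a) =
      1 / ((a 0 : ℝ) + cfVal ((List.range n).map fun i => a (i + 1))) := by
  rw [List.range_succ_eq_map, List.map_cons, cfVal, List.map_map]
  rfl

theorem HasContFrac.pos {a : ℕ → ℕ} {x : ℝ} (h : HasContFrac a x) : 0 < x := by
  have h0 : (0 : ℝ) < a 0 := by exact_mod_cast h.1 0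
  refine lt_of_lt_of_le (b := 1 / ((a 0 : ℝ) + 1)) (by positivity)
    (ge_of_tendsto ((tendsto_add_atTop_iff_nat 1).2 h.2) (Eventually.of_forall fun n => ?_))
  have h1 := cfVal_mem_Icc ((List.range n).map fun i => a (i + 1)) (by
    intro k hk
    obtain ⟨i, -, rfl⟩ := List.mem_map.1 hk
    exact h.1 _)
  rw [cfVal_range_succ]
  gcongr
  · linarith [h1.1]
  · exact h1.2

theorem HasContFrac.tail {a : ℕ → ℕ} {x : ℝ} (h : HasContFrac a x) :
    HasContFrac (fun i => a (i + 1)) (1 / x - a 0) := by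
  refine ⟨fun i => h.1 _, ?_⟩
  have h0 : Tendsto (fun n => cfVal ((List.range (n + 1)).map a)) atTop (𝓝 x) :=
    (tendsto_add_atTop_iff_nat 1).2 h.2
  have h1 := ((tendsto_const_nhds (x := (1 : ℝ))).div h0 h.pos.ne').sub_const (a 0 : ℝ)
  refine h1.congr fun n => ?_
  rw [Pi.div_apply, cfVal_range_succ, one_div_one_div, add_sub_cancel_left]

theorem HasContFrac.bounds {a : ℕ → ℕ} {x : ℝ} (h : HasContFrac a x) : 0 < x ∧ x < 1 := by
  refine ⟨h.pos, ?_⟩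
  have h1 : (1 : ℝ) ≤ a 0 := by exact_mod_cast h.1 0
  have h2 : 1 < 1 / x := by linarith [h.tail.pos]
  rwa [lt_div_iff₀ h.pos, one_mul] at h2

theorem HasContFrac.head_eq {a a' : ℕ → ℕ} {x : ℝ} (h : HasContFrac a x) (h' : HasContFrac a' x) :
    a 0 = a' 0 := by
  obtain ⟨h1, h2⟩ := h.tail.bounds
  obtain ⟨h3, h4⟩ := h'.tail.bounds
  have h5 : (a 0 : ℝ) < a' 0 + 1 := by linarith
  have h6 : (a' 0 : ℝ) < a 0 + 1 := by linarith
  have h7 : a 0 < a' 0 + 1 := by exact_mod_cast h5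
  have h8 : a' 0 < a 0 + 1 := by exact_mod_cast h6
  omega

/-- The number whose base-`b` expansion is the concatenation of the digit strings of the `a i`. -/
noncomputable def concatVal (b : ℕ) (a : ℕ → ℕ) : ℝ :=
  ∑' i : ℕ, (a i : ℝ) / (b : ℝ) ^ (∑ j ∈ Finset.range (i + 1), digLen b (a j))

theorem sum_concat_le {b : ℕ} (hb : 2 ≤ b) (a : ℕ → ℕ) (n : ℕ) :
    ∑ i ∈ Finset.range n, (a i : ℝ) / (b : ℝ) ^ (∑ j ∈ Finset.range (i + 1), digLen b (a j)) ≤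
      1 - 1 / (b : ℝ) ^ (∑ j ∈ Finset.range n, digLen b (a j)) := by
  have hb0 : (0 : ℝ) < b := by exact_mod_cast (by omega : 0 < b)
  induction n with
  | zero => simp
  | succ n ih =>
    rw [Finset.sum_range_succ]
    have h1 : (a n : ℝ) + 1 ≤ (b : ℝ) ^ digLen b (a n) := by
      exact_mod_cast Nat.lt_base_pow_length_digits (by omega : 1 < b)
    have h2 : (a n : ℝ) / (b : ℝ) ^ (∑ j ∈ Finset.range (n + 1), digLen b (a j)) ≤
        1 / (b : ℝ) ^ (∑ j ∈ Finset.range n, digLen b (a j)) -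
          1 / (b : ℝ) ^ (∑ j ∈ Finset.range (n + 1), digLen b (a j)) := by
      rw [le_sub_iff_add_le, ← add_div, Finset.sum_range_succ, pow_add,
        div_le_div_iff₀ (by positivity) (by positivity)]
      nlinarith [pow_pos hb0 (∑ j ∈ Finset.range n, digLen b (a j))]
    linarith

theorem summable_concat {b : ℕ} (hb : 2 ≤ b) (a : ℕ → ℕ) :
    Summable fun i : ℕ => (a i : ℝ) / (b : ℝ) ^ (∑ j ∈ Finset.range (i + 1), digLen b (a j)) :=
  summable_of_sum_range_le (fun _ => by positivity) fun n =>
    (sum_concat_le hb a n).trans (sub_le_self _ (by positivity))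

theorem concatVal_bounds {b : ℕ} (hb : 2 ≤ b) {a : ℕ → ℕ} (ha : ∀ i, 0 < a i) :
    0 < concatVal b a ∧ concatVal b a ≤ 1 := by
  have hb0 : (0 : ℝ) < b := by exact_mod_cast (by omega : 0 < b)
  have ha0 : (0 : ℝ) < a 0 := by exact_mod_cast ha 0
  constructor
  · exact (summable_concat hb a).tsum_pos (fun _ => by positivity) 0 (by positivity)
  · exact Real.tsum_le_of_sum_range_le (fun _ => by positivity) fun n =>
      (sum_concat_le hb a n).trans (sub_le_self _ (by positivity))

theorem concatVal_mul_pow {b : ℕ} (hb : 2 ≤ b) (a : ℕ → ℕ) :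
    concatVal b a * (b : ℝ) ^ digLen b (a 0) = a 0 + concatVal b fun i => a (i + 1) := by
  have hb0 : (0 : ℝ) < b := by exact_mod_cast (by omega : 0 < b)
  unfold concatVal
  rw [(summable_concat hb a).tsum_eq_zero_add, add_mul, ← tsum_mul_right]
  congr 1
  · simp only [zero_add, Finset.sum_range_one]
    field_simp
  · refine tsum_congr fun i => ?_
    rw [Finset.sum_range_succ', pow_add]
    field_simp

theorem digLen_bounds {b m : ℕ} (hb : 2 ≤ b) (hm : 0 < m) :
    1 ≤ digLen b m ∧ b ^ digLen b m ≤ b * m ∧ m < b ^ digLen b m := by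
  refine ⟨?_, Nat.base_pow_length_digits_le b m (by omega) hm.ne',
    Nat.lt_base_pow_length_digits (by omega)⟩
  rw [Nat.one_le_iff_ne_zero, digLen, ne_eq, List.length_eq_zero_iff]
  exact Nat.digits_ne_nil_iff_ne_zero.2 hm.ne'

/-- The first two digit blocks of a Trott number. The base lies strictly between consecutive
squares, and it factors through the first two complete quotients. -/
theorem IsTrottWith.exists_factor {b : ℕ} (hb : 2 ≤ b) {x : ℝ} {a : ℕ → ℕ}
    (h : IsTrottWith b x a) :
    ∃ y w : ℝ, ∃ d : ℕ, (b : ℝ) = (a 0 + y) * (1 / x) ∧ y * (b : ℝ) ^ d = a 1 + w ∧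
      0 < y ∧ y ≤ 1 ∧ 0 < w ∧ w ≤ 1 ∧ 1 ≤ d ∧ b ^ d ≤ b * a 1 ∧ a 1 < b ^ d := by
  obtain ⟨ha, hlim, hx⟩ := h
  have hcf : HasContFrac a x := ⟨ha, hlim⟩
  have hx0 := hcf.pos
  obtain ⟨hz0, hz1⟩ := hcf.tail.bounds
  change x = concatVal b a at hx
  obtain ⟨hd1, hd2, hd3⟩ := digLen_bounds hb (ha 1)
  obtain ⟨hl1, hl2, hl3⟩ := digLen_bounds hb (ha 0)
  obtain ⟨hy0, hy1⟩ := concatVal_bounds hb (a := fun i => a (i + 1)) fun i => ha _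
  obtain ⟨hw0, hw1⟩ := concatVal_bounds hb (a := fun i => a (i + 1 + 1)) fun i => ha _
  refine ⟨concatVal b fun i => a (i + 1), concatVal b fun i => a (i + 1 + 1), digLen b (a 1), ?_,
    concatVal_mul_pow hb fun i => a (i + 1), hy0, hy1, hw0, hw1, hd1, hd2, hd3⟩
  have h1 := concatVal_mul_pow hb a
  rw [← hx] at h1
  set y := concatVal b fun i => a (i + 1)
  have h2 : (b : ℝ) ^ digLen b (a 0) = (a 0 + y) * (1 / x) := by
    rw [← h1]; field_simp
  suffices h3 : digLen b (a 0) = 1 by rw [h3, pow_one] at h2; exact h2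
  by_contra h3
  obtain ⟨m, hm⟩ : ∃ m, digLen b (a 0) = m + 2 := ⟨digLen b (a 0) - 2, by omega⟩
  rw [hm] at h2 hl2
  have ha0 : (1 : ℝ) ≤ a 0 := by exact_mod_cast ha 0
  have h4 : (a 0 : ℝ) ^ 2 < (b : ℝ) ^ (m + 2) := by
    rw [h2]
    nlinarith
  have h5 : a 0 ^ 2 < b ^ (m + 2) := by exact_mod_cast h4
  have h6 : b ^ (m + 1) ≤ a 0 := by
    refine Nat.le_of_mul_le_mul_left (le_trans (le_of_eq ?_) hl2) (by omega : 0 < b)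
    ring
  have h7 : b ^ (m + 2) ≤ (b ^ (m + 1)) ^ 2 := by
    rw [← pow_mul]
    exact Nat.pow_le_pow_right (by omega) (by omega)
  exact absurd (h5.trans_le (h7.trans (Nat.pow_le_pow_left h6 2))) (lt_irrefl _)

/-- The product `r P` is close to `A N`. -/
theorem sub_mem_Icc_of_factor {A N P r w y z : ℝ} (hA : 100 ≤ A) (hN : A ^ 2 ≤ N) (hz0 : 0 < z)
    (hzN : z * N ≤ 1) (hy1 : y ≤ 1) (hw0 : 0 < w) (hw1 : w ≤ 1) (hP : 0 < P)
    (hyP : y * P = N + w) (hr : r = A * y + A * z + y * z) (hr1 : 1 ≤ r) :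
    0 ≤ r * P - A * N ∧ r * P - A * N ≤ 2 * A ^ 2 := by
  have h1 : r * P - A * N = A * w + A * (z * P) + z * N + z * w := by
    rw [hr]
    linear_combination (A + z) * hyP
  have hN0 : 0 < N := by nlinarith
  have hzA : z * A ^ 2 ≤ 1 := by nlinarith
  have hzA' : A * z ≤ 1 / 100 := by
    by_contra! h
    nlinarith
  have hz1 : z ≤ 1 / 100 := by nlinarith
  have hyz : y * z ≤ 1 / 100 := by nlinarith
  have hAy : 98 / 100 ≤ A * y := by linarith
  have h2 : 98 / 100 * P ≤ A * (N + w) := by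
    rw [← hyP]
    nlinarith
  have h3 : 98 / 100 * (z * P) ≤ A * (1 + 1 / 100) := by
    have e1 : z * (98 / 100 * P) ≤ z * (A * (N + w)) := by gcongr
    have e2 : z * w ≤ 1 / 100 := by nlinarith
    have e3 : A * (z * N + z * w) ≤ A * (1 + 1 / 100) := by gcongr
    linarith
  have h4 : A * (98 / 100 * (z * P)) ≤ A * (A * (1 + 1 / 100)) := by gcongr
  rw [h1]
  constructor
  · positivity
  · nlinarith

/-- If `c > b > 1.185 × 10²⁹`, then no number is Trott in both base `b` and base `c`. -/
theorem trott_not_large_bases (b c : ℕ) (hb : 1.185 * 10 ^ 29 < (b : ℝ)) (hbc : b < c) :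
    TrottSet b ∩ TrottSet c = ∅ := by
  have hb96 : 2 ^ 96 ≤ b := by
    have h1 : ((2 ^ 96 : ℕ) : ℝ) < b := lt_trans (by norm_num) hb
    exact (Nat.cast_lt.1 h1).le
  rw [Set.eq_empty_iff_forall_notMem]
  rintro x ⟨⟨a, ha⟩, ⟨a', ha'⟩⟩
  have hcf : HasContFrac a x := ⟨ha.1, ha.2.1⟩
  have hcf' : HasContFrac a' x := ⟨ha'.1, ha'.2.1⟩
  have h0 : a' 0 = a 0 := hcf'.head_eq hcf
  have h1 : a' 1 = a 1 := by
    have h2 := hcf'.tail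
    rw [h0] at h2
    exact h2.head_eq hcf.tail
  obtain ⟨y, w, d, hbx, hyd, hy0, hy1, hw0, hw1, hd1, hdl, hdu⟩ := ha.exists_factor (by omega)
  obtain ⟨y', w', n, hcx, hyn, hy0', hy1', hw0', hw1', hn1, hnl, hnu⟩ :=
    ha'.exists_factor (by omega)
  rw [h0] at hcx
  rw [h1] at hyn hnl hnu
  obtain ⟨hz0, hz1⟩ := hcf.tail.bounds
  have hu0 := hcf.tail.tail.bounds.1
  simp only [zero_add] at hu0
  have hA1 : 1 ≤ a 0 := ha.1 0
  set A := a 0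
  set N := a 1
  set z := 1 / x - A with hz
  have hxz : 1 / x = A + z := by rw [hz]; ring
  rw [hxz] at hbx hcx
  have hzN : z * N ≤ 1 := by
    have h2 : (N : ℝ) < 1 / z := by linarith
    rw [lt_div_iff₀ hz0] at h2
    linarith
  have hA1' : (1 : ℝ) ≤ A := by exact_mod_cast hA1
  have hAb : A ^ 2 < b := by
    have : (A : ℝ) ^ 2 < b := by rw [hbx]; nlinarith
    exact_mod_cast this
  have hAc : c < (A + 1) ^ 2 := by
    have : (c : ℝ) < (A + 1) ^ 2 := by rw [hcx]; nlinarith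
    exact_mod_cast this
  have hbc' : (b : ℝ) + 1 ≤ c := by exact_mod_cast hbc
  have hbR : (A : ℝ) ^ 2 + 1 ≤ b := by exact_mod_cast hAb
  have hb0 : (0 : ℝ) < b := by positivity
  have hc0 : (0 : ℝ) < c := by linarith
  have hnd : n < d := by
    by_contra! hdn
    rcases hdn.eq_or_lt with rfl | hlt
    · have e1 : (y' - y) * (b : ℝ) ^ d ≤ 1 := by
        have e2 : y' * (b : ℝ) ^ d ≤ y' * (c : ℝ) ^ d := by gcongr
        linarith
      have e3 : (b : ℝ) ≤ (b : ℝ) ^ d := by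
        simpa using pow_le_pow_right₀ (by linarith : (1 : ℝ) ≤ b) hd1
      have e4 : 1 ≤ (y' - y) * (A + z) := by linarith
      have e5 : 0 < y' - y := pos_of_mul_pos_left (by linarith) (by linarith : (0 : ℝ) ≤ A + z)
      have e6 : (A : ℝ) + z < b := by
        have : (A : ℝ) ≤ A ^ 2 := le_self_pow₀ hA1' two_ne_zero
        linarith
      have e7 : (y' - y) * (A + z) < (y' - y) * b := by gcongr
      have e8 : (y' - y) * b ≤ (y' - y) * (b : ℝ) ^ d := by gcongr
      linarith
    · have e1 : c ^ (n - 1) ≤ N := by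
        refine Nat.le_of_mul_le_mul_left (le_trans (le_of_eq ?_) hnl) (by omega : 0 < c)
        rw [← pow_succ', Nat.sub_add_cancel hn1]
      have e2 : b ^ d ≤ c ^ (n - 1) :=
        (Nat.pow_le_pow_left hbc.le d).trans (Nat.pow_le_pow_right (by omega) (by omega))
      omega
  have hbN : b ≤ N := by
    refine Nat.le_of_mul_le_mul_left (le_trans ?_ hdl) (by omega : 0 < b)
    rw [← sq]
    exact Nat.pow_le_pow_right (by omega) (by omega)
  have hA100 : 100 ≤ A := by
    by_contra! h
    have : (A + 1) ^ 2 ≤ 100 ^ 2 := Nat.pow_le_pow_left (by omega) 2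
    omega
  have hA100' : (100 : ℝ) ≤ A := by exact_mod_cast hA100
  have hbN' : (b : ℝ) ≤ N := by exact_mod_cast hbN
  obtain ⟨r, hr⟩ : ∃ r, b = A ^ 2 + r := ⟨b - A ^ 2, by omega⟩
  obtain ⟨s, hs⟩ : ∃ s, c = A ^ 2 + s := ⟨c - A ^ 2, by omega⟩
  have hr1 : 1 ≤ r := by omega
  have hs1 : 1 ≤ s := by omega
  have hs2 : s ≤ 2 * A := by
    have : (A + 1) ^ 2 = A ^ 2 + 2 * A + 1 := by ring
    omega
  have hrR : (b : ℝ) = A ^ 2 + r := by exact_mod_cast hr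
  have hsR : (c : ℝ) = A ^ 2 + s := by exact_mod_cast hs
  have hs2R : (s : ℝ) ≤ 2 * A := by exact_mod_cast hs2
  have hr1R : (1 : ℝ) ≤ r := by exact_mod_cast hr1
  have hs1R : (1 : ℝ) ≤ s := by exact_mod_cast hs1
  obtain ⟨b1, b2⟩ := sub_mem_Icc_of_factor (r := r) hA100' (by linarith) hz0 hzN hy1 hw0 hw1
    (by positivity) hyd (by linear_combination hbx - hrR) hr1R
  obtain ⟨c1, c2⟩ := sub_mem_Icc_of_factor (r := s) hA100' (by linarith) hz0 hzN hy1' hw0' hw1'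
    (by positivity) hyn (by linear_combination hcx - hsR) hs1R
  refine not_abs_sub_le hb96 hbc (k := d - n) (n := n) ?_ hr1 hs1 ?_ (by omega) hn1 ?_
  · have e1 : ((c : ℝ) - b) ^ 2 ≤ (2 * A) ^ 2 :=
      pow_le_pow_left₀ (by linarith) (by linarith) 2
    linarith
  · have e1 : (s : ℝ) ^ 2 ≤ (2 * A) ^ 2 := pow_le_pow_left₀ (by linarith) hs2R 2
    linarith
  · rw [Nat.add_sub_cancel' hnd.le, abs_le]
    constructor <;> linarith
end

section
/- Suppose x = [0;a_1,a_2,…] is a Trott number in base b and its second partial quotient a_2 has exactly l digits in base b, where l ≥ 2. (i) If b = k²+1 with k ≥ 3, or if b = 5 and l ≥ 3 (with k = 2), then a_2 = ((k²+1)^l − (k²+1))/k − 1. (ii) If b = k²+k with k ≥ 2, then a_2 = b^l − 2 = (k²+k)^l − 2. -/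
open Filter Topology

theorem cfVal_mem_Icc_s14 (s : List ℕ) (hs : ∀ i ∈ s, 0 < i) : 0 ≤ cfVal s ∧ cfVal s ≤ 1 := by
  induction s with
  | nil => simp [cfVal]
  | cons h t ih =>
    obtain ⟨h0, -⟩ := ih fun i hi => hs i (List.mem_cons_of_mem _ hi)
    have h1 : (1 : ℝ) ≤ h := by exact_mod_cast hs h List.mem_cons_self
    simp only [cfVal]
    refine ⟨by positivity, ?_⟩
    rw [div_le_one (by linarith)]
    linarith

/-- Bounds on a continued fraction in terms of its first two partial quotients. -/
theorem cf_limit_bounds {x : ℝ} {a : ℕ → ℕ} (ha : ∀ i, 0 < a i)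
    (hx : Tendsto (fun n => cfVal ((List.range n).map a)) atTop (𝓝 x)) :
    (a 1 : ℝ) ≤ x * (a 0 * a 1 + 1) ∧ x * (a 0 * (a 1 + 1) + 1) ≤ a 1 + 1 := by
  have h0 : (0 : ℝ) < a 0 := by exact_mod_cast ha 0
  have h1 : (0 : ℝ) < a 1 := by exact_mod_cast ha 1
  have key : ∀ n, (a 1 : ℝ) / (a 0 * a 1 + 1) ≤ cfVal ((List.range (n + 2)).map a) ∧
      cfVal ((List.range (n + 2)).map a) ≤ (a 1 + 1) / (a 0 * (a 1 + 1) + 1) := by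
    intro n
    have hlist : (List.range (n + 2)).map a =
        a 0 :: a 1 :: (List.range n).map (fun i => a (i + 2)) := by
      rw [List.range_succ_eq_map, List.range_succ_eq_map]
      simp [Function.comp_def]
    obtain ⟨ht0, ht1⟩ := cfVal_mem_Icc_s14 ((List.range n).map (fun i => a (i + 2)))
      (by simp only [List.mem_map]; rintro _ ⟨i, -, rfl⟩; exact ha _)
    rw [hlist]
    simp only [cfVal]
    generalize cfVal ((List.range n).map (fun i => a (i + 2))) = t at ht0 ht1
    have hval : 1 / ((a 0 : ℝ) + 1 / (a 1 + t)) = (a 1 + t) / (a 0 * (a 1 + t) + 1) := by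
      have : (0 : ℝ) < a 1 + t := by linarith
      field_simp
    rw [hval]
    constructor <;> rw [div_le_div_iff₀ (by positivity) (by positivity)] <;> nlinarith
  have hx2 := (tendsto_add_atTop_iff_nat 2).2 hx
  have hlo := ge_of_tendsto' hx2 fun n => (key n).1
  have hhi := le_of_tendsto' hx2 fun n => (key n).2
  rw [div_le_iff₀ (by positivity)] at hlo
  rw [le_div_iff₀ (by positivity)] at hhi
  exact ⟨hlo, hhi⟩

/-- Bounds on a concatenated base-`b` expansion in terms of its first two blocks. -/
theorem digit_sum_bounds {b : ℕ} (hb : 2 ≤ b) (a : ℕ → ℕ) {x : ℝ}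
    (hx : x = ∑' i : ℕ, (a i : ℝ) / (b : ℝ) ^ (∑ j ∈ Finset.range (i + 1), digLen b (a j))) :
    (a 0 : ℝ) * b ^ digLen b (a 1) + a 1 ≤ x * b ^ (digLen b (a 0) + digLen b (a 1)) ∧
    x * b ^ (digLen b (a 0) + digLen b (a 1)) ≤ a 0 * b ^ digLen b (a 1) + a 1 + 1 := by
  have hb0 : (0 : ℝ) < b := by exact_mod_cast (by omega : 0 < b)
  set f : ℕ → ℝ := fun i => (a i : ℝ) / (b : ℝ) ^ (∑ j ∈ Finset.range (i + 1), digLen b (a j))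
    with hf
  have hf0 : ∀ i, 0 ≤ f i := fun i => by simp only [hf]; positivity
  let g : ℕ → ℝ := fun n => ∑ i ∈ Finset.range n, f i +
    1 / (b : ℝ) ^ (∑ j ∈ Finset.range n, digLen b (a j))
  have hg : Antitone g := by
    refine antitone_nat_of_succ_le fun n => ?_
    simp only [g]
    rw [Finset.sum_range_succ f, add_assoc]
    gcongr
    simp only [hf]
    rw [Finset.sum_range_succ, pow_add, ← add_div, div_le_div_iff₀ (by positivity) (by positivity)]
    have hlt : (a n : ℝ) + 1 ≤ (b : ℝ) ^ digLen b (a n) := by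
      exact_mod_cast Nat.lt_base_pow_length_digits (b := b) (m := a n) (by omega)
    have hp : (0 : ℝ) < (b : ℝ) ^ (∑ j ∈ Finset.range n, digLen b (a j)) := by positivity
    nlinarith
  have hle : ∀ n, ∑ i ∈ Finset.range n, f i ≤ g n := fun n => by
    simp only [g]
    have : (0 : ℝ) ≤ 1 / (b : ℝ) ^ (∑ j ∈ Finset.range n, digLen b (a j)) := by positivity
    linarith
  have hsum : Summable f :=
    summable_of_sum_range_le hf0 fun n => (hle n).trans (hg (Nat.zero_le n))
  have hlo : ∑ i ∈ Finset.range 2, f i ≤ x := hx ▸ hsum.sum_le_tsum _ fun i _ => hf0 i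
  have hhi : x ≤ g 2 := by
    rw [hx]
    refine le_of_tendsto hsum.hasSum.tendsto_sum_nat ?_
    filter_upwards [eventually_ge_atTop 2] with n hn using (hle n).trans (hg hn)
  simp only [g] at hhi
  have hpos0 : (0 : ℝ) < (b : ℝ) ^ digLen b (a 0) := by positivity
  have hpos1 : (0 : ℝ) < (b : ℝ) ^ digLen b (a 1) := by positivity
  have hS : ∑ i ∈ Finset.range 2, f i = (a 0 * b ^ digLen b (a 1) + a 1) /
      (b ^ (digLen b (a 0) + digLen b (a 1))) := by
    simp only [hf, Finset.sum_range_succ, Finset.sum_range_zero, zero_add, pow_add]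
    field_simp
  have hT : ∑ j ∈ Finset.range 2, digLen b (a j) = digLen b (a 0) + digLen b (a 1) := by
    simp [Finset.sum_range_succ]
  rw [hS] at hlo
  rw [hS, hT, ← add_div] at hhi
  exact ⟨(div_le_iff₀ (by positivity)).1 hlo, (le_div_iff₀ (by positivity)).1 hhi⟩

theorem trott_quotient_bounds {b : ℕ} (hb : 2 ≤ b) {x : ℝ} {a : ℕ → ℕ} (hx : IsTrottWith b x a) :
    (a 0 * b ^ digLen b (a 1) + a 1) * (a 0 * (a 1 + 1) + 1) ≤
      b ^ (digLen b (a 0) + digLen b (a 1)) * (a 1 + 1) ∧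
    b ^ (digLen b (a 0) + digLen b (a 1)) * a 1 ≤
      (a 0 * b ^ digLen b (a 1) + a 1 + 1) * (a 0 * a 1 + 1) := by
  obtain ⟨ha, hcf, hsum⟩ := hx
  obtain ⟨c1, c2⟩ := cf_limit_bounds ha hcf
  obtain ⟨d1, d2⟩ := digit_sum_bounds hb a hsum
  set Q : ℝ := (b : ℝ) ^ (digLen b (a 0) + digLen b (a 1)) with hQ
  have hQ0 : 0 ≤ Q := by positivity
  have e1 : ((a 0 : ℝ) * b ^ digLen b (a 1) + a 1) * (a 0 * (a 1 + 1) + 1) ≤ Q * (a 1 + 1) :=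
    calc _ ≤ x * Q * (a 0 * (a 1 + 1) + 1) := by gcongr
      _ = Q * (x * (a 0 * (a 1 + 1) + 1)) := by ring
      _ ≤ _ := by gcongr
  have e2 : Q * a 1 ≤ ((a 0 : ℝ) * b ^ digLen b (a 1) + a 1 + 1) * (a 0 * a 1 + 1) :=
    calc _ ≤ Q * (x * (a 0 * a 1 + 1)) := by gcongr
      _ = x * Q * (a 0 * a 1 + 1) := by ring
      _ ≤ _ := by gcongr
  rw [hQ] at e1 e2
  exact ⟨by exact_mod_cast e1, by exact_mod_cast e2⟩

/-- The first partial quotient has a single digit and is the integer part of `√b`. -/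
theorem trott_first_quotient {b : ℕ} (hb : 2 ≤ b) {x : ℝ} {a : ℕ → ℕ} (hx : IsTrottWith b x a) :
    digLen b (a 0) = 1 ∧ a 0 ^ 2 < b ∧ b ≤ (a 0 + 1) ^ 2 := by
  obtain ⟨hA, hB⟩ := trott_quotient_bounds hb hx
  have h0 := hx.1 0
  have h1 := hx.1 1
  have hlen : b ^ digLen b (a 0) ≤ b * a 0 :=
    Nat.base_pow_length_digits_le b (a 0) hb (by omega)
  have hlt : a 1 + 1 ≤ b ^ digLen b (a 1) := Nat.lt_base_pow_length_digits (by omega)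
  rw [pow_add] at hA hB
  have hsq : a 0 ^ 2 < b ^ digLen b (a 0) := by
    by_contra! h
    have hpos : 0 < a 0 * b ^ digLen b (a 1) + a 1 * (a 0 * (a 1 + 1) + 1) := by positivity
    have := Nat.mul_le_mul_right (b ^ digLen b (a 1) * (a 1 + 1)) h
    nlinarith
  have hone : digLen b (a 0) = 1 := by
    have hlb : a 0 < b := by nlinarith
    simp only [digLen, Nat.digits_of_lt b (a 0) (by omega) hlb, List.length_singleton]
  rw [hone, pow_one] at hsq hB
  refine ⟨hone, hsq, ?_⟩
  have hpos : 0 < b ^ digLen b (a 1) * a 1 := by positivity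
  refine Nat.le_of_mul_le_mul_left (c := b ^ digLen b (a 1) * a 1) ?_ hpos
  calc b ^ digLen b (a 1) * a 1 * b = b * b ^ digLen b (a 1) * a 1 := by ring
    _ ≤ (a 0 * b ^ digLen b (a 1) + a 1 + 1) * (a 0 * a 1 + 1) := hB
    _ ≤ (a 0 * b ^ digLen b (a 1) + b ^ digLen b (a 1)) * (a 0 * a 1 + a 1) :=
        Nat.mul_le_mul (by omega) (by omega)
    _ = _ := by ring

theorem quadratic_neg_of_endpoints_neg {α β γ c d m : ℤ} (hα : 0 ≤ α) (hcm : c ≤ m) (hmd : m ≤ d)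
    (hc : α * c ^ 2 + β * c + γ < 0) (hd : α * d ^ 2 + β * d + γ < 0) :
    α * m ^ 2 + β * m + γ < 0 := by
  rcases hcm.eq_or_lt with rfl | hlt
  · exact hc
  by_contra! h
  have h1 := mul_nonneg (mul_nonneg hα (sub_nonneg.2 hcm))
    (mul_nonneg (sub_nonneg.2 hmd) (sub_nonneg.2 (hcm.trans hmd)))
  have h2 := mul_nonneg (sub_nonneg.2 (hcm.trans hmd)) h
  have h3 := mul_nonpos_of_nonneg_of_nonpos (sub_nonneg.2 hmd) hc.le
  have h4 := mul_neg_of_pos_of_neg (sub_pos.2 hlt) hd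
  nlinarith

/-- Solving the two bounds for the second quotient when `b = k² + 1`; here `c` is `b ^ (l - 1)`. -/
theorem second_quotient_sq_add_one {k c m M : ℤ} (hk : 2 ≤ k) (hc : k ^ 2 + 1 ≤ c)
    (h : 3 ≤ k ∨ k = 2 ∧ 25 ≤ c) (hM : (k ^ 2 + 1) * c - (k ^ 2 + 1) = k * M) (hcm : c ≤ m)
    (hA : (k * ((k ^ 2 + 1) * c) + m) * (k * (m + 1) + 1) ≤
      (k ^ 2 + 1) * ((k ^ 2 + 1) * c) * (m + 1))
    (hB : (k ^ 2 + 1) * ((k ^ 2 + 1) * c) * m ≤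
      (k * ((k ^ 2 + 1) * c) + m + 1) * (k * m + 1)) :
    m = M - 1 := by
  set P := (k ^ 2 + 1) * c with hP
  have hPpos : 0 < P := by nlinarith
  have hm : 0 < m := by nlinarith
  apply le_antisymm
  · by_contra! hlt
    obtain ⟨j, rfl⟩ : ∃ j, m = M + j := ⟨m - M, by ring⟩
    have hj : 0 ≤ j := by linarith
    have key : P * (k - 1) ≤ k * (M + j) * (k - 1 - j) := by
      linear_combination hA + (M + j) * hM
    have hj2 : 0 < k - 1 - j := by
      by_contra! hle
      have := mul_nonpos_of_nonneg_of_nonpos (by positivity : 0 ≤ k * (M + j)) hle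
      have := mul_pos hPpos (by linarith : 0 < k - 1)
      linarith
    have h1 : k * (M + j) < P := by nlinarith
    have h2 := mul_lt_mul_of_pos_right h1 hj2
    have h3 := mul_nonneg hPpos.le hj
    linarith
  · by_contra! hlt
    have hneg : k * m ^ 2 + (k + 1 - P) * m + (1 + k * P) < 0 := by
      refine quadratic_neg_of_endpoints_neg (c := c) (d := M - 2) (by linarith) hcm (by linarith)
        ?_ ?_
      · have : k ^ 3 + 2 * k + 2 ≤ c * (k ^ 2 - k + 1) - 1 := by
          rcases h with h | ⟨rfl, h⟩
          · have := mul_le_mul_of_nonneg_right hc (by nlinarith : 0 ≤ k ^ 2 - k + 1)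
            nlinarith [mul_nonneg (by linarith : 0 ≤ k - 3) (by positivity : 0 ≤ k ^ 3),
              mul_nonneg (by linarith : 0 ≤ k - 3) (by positivity : 0 ≤ k ^ 2)]
          · linarith
        rw [hP]
        nlinarith
      · have hbig : k ^ 3 + 3 * k ^ 2 + 3 * k + 2 < P := by
          rcases h with h | ⟨rfl, h⟩
          · have := mul_le_mul_of_nonneg_left hc (by positivity : 0 ≤ k ^ 2 + 1)
            nlinarith [mul_nonneg (by linarith : 0 ≤ k - 3) (by positivity : 0 ≤ k ^ 3),
              mul_nonneg (by linarith : 0 ≤ k - 3) (by positivity : 0 ≤ k ^ 2)]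
          · linarith
        have heq : k * (M - 2) ^ 2 + (k + 1 - P) * (M - 2) + (1 + k * P) =
            k ^ 3 + 3 * k ^ 2 + 3 * k + 2 - P := by
          linear_combination (k + 3 - M) * hM
        linarith
    nlinarith

/-- Solving the two bounds for the second quotient when `b = k² + k`; here `c` is `b ^ (l - 1)`. -/
theorem second_quotient_sq_add_self {k c m : ℤ} (hk : 2 ≤ k) (hc : k ^ 2 + k ≤ c) (hcm : c ≤ m)
    (hA : (k * ((k ^ 2 + k) * c) + m) * (k * (m + 1) + 1) ≤
      (k ^ 2 + k) * ((k ^ 2 + k) * c) * (m + 1))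
    (hB : (k ^ 2 + k) * ((k ^ 2 + k) * c) * m ≤
      (k * ((k ^ 2 + k) * c) + m + 1) * (k * m + 1)) :
    m = (k ^ 2 + k) * c - 2 := by
  set P := (k ^ 2 + k) * c with hP
  have hc6 : 6 ≤ c := by nlinarith
  have hm : 0 < m := by linarith
  apply le_antisymm
  · have h1 : m * (k * m + k + 1) ≤ m * (k * P) := by linear_combination hA
    have h2 := le_of_mul_le_mul_left h1 hm
    by_contra! hlt
    nlinarith
  · by_contra! hlt
    have hneg : k * m ^ 2 + (k + 1 - k * P) * m + (1 + k * P) < 0 := by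
      refine quadratic_neg_of_endpoints_neg (c := c) (d := P - 3) (by linarith) hcm (by linarith)
        ?_ ?_
      · have hb : 6 ≤ k ^ 2 + k := by nlinarith
        have h1 : k + 2 + k * (k ^ 2 + k) < c * (k * (k ^ 2 + k - 1)) := by
          have := mul_le_mul_of_nonneg_right hc6
            (mul_nonneg (by linarith) (by linarith) : 0 ≤ k * (k ^ 2 + k - 1))
          nlinarith
        have h2 := mul_lt_mul_of_pos_left h1 (by linarith : 0 < c)
        rw [hP]
        nlinarith
      · have hbig : 36 ≤ P := by nlinarith
        nlinarith
    nlinarith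

/-- Special cases of the formula for the second partial quotient `a 1` of a Trott number
in base `b`, when `a 1` has exactly `l ≥ 2` digits in base `b`:
(i) if `b = k²+1` with `k ≥ 3`, or `b = 5` (`k = 2`) and `l ≥ 3`, then
`a 1 = ((k²+1)ˡ − (k²+1))/k − 1`;
(ii) if `b = k²+k` with `k ≥ 2`, then `a 1 = bˡ − 2 = (k²+k)ˡ − 2`. -/
theorem trott_second_quotient_special_cases (b l : ℕ) (hl : 2 ≤ l)
    (x : ℝ) (a : ℕ → ℕ) (hx : IsTrottWith b x a) (hdig : digLen b (a 1) = l) :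
    (∀ k : ℕ, ((3 ≤ k ∧ b = k ^ 2 + 1) ∨ (k = 2 ∧ b = 5 ∧ 3 ≤ l)) →
      (a 1 : ℝ) = (((k : ℝ) ^ 2 + 1) ^ l - ((k : ℝ) ^ 2 + 1)) / (k : ℝ) - 1) ∧
    (∀ k : ℕ, 2 ≤ k → b = k ^ 2 + k →
      (a 1 : ℤ) = (b : ℤ) ^ l - 2 ∧ (a 1 : ℤ) = ((k : ℤ) ^ 2 + k) ^ l - 2) := by
  obtain ⟨e, rfl⟩ : ∃ e, l = e + 1 := ⟨l - 1, by omega⟩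
  have he : e ≠ 0 := by omega
  have setup : ∀ k, 2 ≤ k → k ^ 2 < b → b ≤ (k + 1) ^ 2 →
      (b : ℤ) ≤ (b : ℤ) ^ e ∧ (b : ℤ) ^ e ≤ a 1 ∧
      ((k : ℤ) * (b * b ^ e) + a 1) * (k * (a 1 + 1) + 1) ≤ b * (b * b ^ e) * (a 1 + 1) ∧
      (b : ℤ) * (b * b ^ e) * a 1 ≤ (k * (b * b ^ e) + a 1 + 1) * (k * a 1 + 1) := by
    intro k hk hlo hhi
    have hb : 2 ≤ b := by nlinarith
    obtain ⟨hlen, hsq, hsq'⟩ := trott_first_quotient hb hx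
    obtain ⟨hA, hB⟩ := trott_quotient_bounds hb hx
    have hak : a 0 = k := by
      have h1 : a 0 < k + 1 := lt_of_pow_lt_pow_left₀ 2 (by omega) (hsq.trans_le hhi)
      have h2 : k < a 0 + 1 := lt_of_pow_lt_pow_left₀ 2 (by omega) (hlo.trans_le hsq')
      omega
    have hpow : b ^ (digLen b (a 1)) ≤ b * a 1 :=
      Nat.base_pow_length_digits_le b (a 1) hb (hx.1 1).ne'
    rw [hdig, pow_succ'] at hpow
    rw [hlen, hdig, hak, pow_add b 1, pow_one, pow_succ' b e] at hA hB
    refine ⟨?_, ?_, by exact_mod_cast hA, by exact_mod_cast hB⟩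
    · exact_mod_cast Nat.le_self_pow he b
    · exact_mod_cast Nat.le_of_mul_le_mul_left hpow (by omega)
  constructor
  · intro k hk
    have hk2 : 2 ≤ k := by omega
    have hbk : b = k ^ 2 + 1 := by
      rcases hk with ⟨-, h⟩ | ⟨rfl, h, -⟩ <;> simpa using h
    obtain ⟨h1, h2, h3, h4⟩ := setup k hk2 (by omega) (by rw [hbk]; nlinarith)
    have hbZ : (b : ℤ) = (k : ℤ) ^ 2 + 1 := by rw [hbk]; push_cast; ring
    have hdvd : (k : ℤ) ∣ ((k : ℤ) ^ 2 + 1) * ((k : ℤ) ^ 2 + 1) ^ e - ((k : ℤ) ^ 2 + 1) := by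
      have hpow : (k : ℤ) ^ 2 ∣ ((k : ℤ) ^ 2 + 1) ^ e - 1 := by
        have := sub_dvd_pow_sub_pow ((k : ℤ) ^ 2 + 1) 1 e
        rwa [add_sub_cancel_right, one_pow] at this
      have := ((dvd_pow_self (k : ℤ) two_ne_zero).trans hpow).mul_left ((k : ℤ) ^ 2 + 1)
      rwa [mul_sub, mul_one] at this
    obtain ⟨M, hM⟩ := hdvd
    have hcase : (3 : ℤ) ≤ k ∨ (k : ℤ) = 2 ∧ (25 : ℤ) ≤ ((k : ℤ) ^ 2 + 1) ^ e := by
      rcases hk with ⟨h, -⟩ | ⟨rfl, -, h⟩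
      · left; exact_mod_cast h
      · refine .inr ⟨rfl, ?_⟩
        calc (25 : ℤ) = 5 ^ 2 := by norm_num
          _ ≤ 5 ^ e := pow_le_pow_right₀ (by norm_num) (by omega)
          _ = _ := by norm_num
    rw [hbZ] at h1 h2 h3 h4
    have hm := second_quotient_sq_add_one (by exact_mod_cast hk2) h1 hcase hM h2 h3 h4
    have hmR : (a 1 : ℝ) = M - 1 := by exact_mod_cast hm
    have hMR : ((k : ℝ) ^ 2 + 1) * ((k : ℝ) ^ 2 + 1) ^ e - ((k : ℝ) ^ 2 + 1) = k * M := by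
      exact_mod_cast hM
    have hk0 : (k : ℝ) ≠ 0 := by exact_mod_cast (by omega : k ≠ 0)
    rw [hmR, pow_succ', hMR, mul_div_cancel_left₀ _ hk0]
  · intro k hk hbk
    obtain ⟨h1, h2, h3, h4⟩ := setup k hk (by omega) (by rw [hbk]; nlinarith)
    have hbZ : (b : ℤ) = (k : ℤ) ^ 2 + k := by rw [hbk]; push_cast; ring
    rw [hbZ] at h1 h2 h3 h4 ⊢
    have hm := second_quotient_sq_add_self (by exact_mod_cast hk) h1 h2 h3 h4
    rw [pow_succ']
    exact ⟨hm, hm⟩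
end

section
/- Let x = [0;a_1,a_2,…] be a Trott number in base b, with second partial quotient a_2. (i) If b = 2, then either a_2 = 4 or a_2 = 2^l − 3 for some integer l ≥ 3. (ii) If b = 3, then necessarily a_2 = 1. -/
open Filter Topology

/-- Finite continued fractions with positive partial quotients lie in `[0, 1]`. -/
theorem cfVal_mem_Icc_s15 (l : List ℕ) (hl : ∀ n ∈ l, 0 < n) : 0 ≤ cfVal l ∧ cfVal l ≤ 1 := by
  induction l with
  | nil => simp [cfVal]
  | cons h t ih =>
    obtain ⟨h0, -⟩ := ih fun n hn => hl n (by simp [hn])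
    have hh : (1 : ℝ) ≤ h := by exact_mod_cast hl h (by simp)
    refine ⟨by simp only [cfVal]; positivity, ?_⟩
    simp only [cfVal]
    rw [div_le_one (by positivity)]
    linarith

/-- The value of an infinite continued fraction in terms of its first two partial quotients and
a remainder in `(0, 1]`. -/
theorem exists_remainder_of_tendsto_cfVal {a : ℕ → ℕ} (ha : ∀ i, 0 < a i) {x : ℝ}
    (hx : Tendsto (fun n => cfVal ((List.range n).map a)) atTop (𝓝 x)) :
    ∃ z : ℝ, 0 < z ∧ z ≤ 1 ∧ x = 1 / ((a 0 : ℝ) + 1 / ((a 1 : ℝ) + z)) := by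
  have ha0 : (0 : ℝ) < a 0 := by exact_mod_cast ha 0
  have ha1 : (0 : ℝ) < a 1 := by exact_mod_cast ha 1
  have hδ : (0 : ℝ) < 1 / ((a 2 : ℝ) + 1) := by positivity
  let f : ℝ → ℝ := fun z => 1 / ((a 0 : ℝ) + 1 / ((a 1 : ℝ) + z))
  have hf : ContinuousOn f (Set.Icc (1 / ((a 2 : ℝ) + 1)) 1) := by
    intro z hz
    have hz0 : 0 < z := hδ.trans_le hz.1
    have h1 : (a 1 : ℝ) + z ≠ 0 := by positivity
    have h2 : (a 0 : ℝ) + 1 / ((a 1 : ℝ) + z) ≠ 0 := by positivity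
    apply ContinuousAt.continuousWithinAt
    fun_prop (disch := assumption)
  have hclosed := (isCompact_Icc.image_of_continuousOn hf).isClosed
  have hmem : x ∈ f '' Set.Icc (1 / ((a 2 : ℝ) + 1)) 1 := by
    refine hclosed.mem_of_tendsto ((tendsto_add_atTop_iff_nat 3).2 hx) (Eventually.of_forall ?_)
    intro n
    let t := (List.range n).map fun i => a (i + 3)
    have ht := cfVal_mem_Icc_s15 t (by simp [t, ha])
    have ht' := cfVal_mem_Icc_s15 (a 2 :: t) (by simp [t, ha])
    refine ⟨cfVal (a 2 :: t), ⟨?_, ht'.2⟩, ?_⟩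
    · have ha2 : (0 : ℝ) < a 2 := by exact_mod_cast ha 2
      simp only [cfVal]
      exact one_div_le_one_div_of_le (by linarith [ht.1]) (by linarith [ht.2])
    · simp [f, t, List.range_succ_eq_map, cfVal, Function.comp_def]
  obtain ⟨z, hz, rfl⟩ := hmem
  exact ⟨z, hδ.trans_le hz.1, hz.2, rfl⟩

theorem lt_pow_digLen {b : ℕ} (hb : 2 ≤ b) (m : ℕ) : m < b ^ digLen b m :=
  Nat.lt_base_pow_length_digits hb

theorem pow_digLen_le {b : ℕ} (hb : 2 ≤ b) {m : ℕ} (hm : 0 < m) : b ^ digLen b m ≤ b * m :=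
  Nat.base_pow_length_digits_le b m hb (Nat.pos_iff_ne_zero.mp hm)

/-- The `i`-th summand in the base-`b` concatenation of the digit strings of `a`. -/
noncomputable def concatTerm (b : ℕ) (a : ℕ → ℕ) (i : ℕ) : ℝ :=
  (a i : ℝ) / (b : ℝ) ^ (∑ j ∈ Finset.range (i + 1), digLen b (a j))

theorem concatTerm_nonneg (b : ℕ) (a : ℕ → ℕ) (i : ℕ) : 0 ≤ concatTerm b a i := by
  unfold concatTerm
  positivity

theorem antitone_sum_concatTerm_add {b : ℕ} (hb : 2 ≤ b) (a : ℕ → ℕ) :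
    Antitone fun n => ∑ i ∈ Finset.range n, concatTerm b a i +
      1 / (b : ℝ) ^ (∑ j ∈ Finset.range n, digLen b (a j)) := by
  refine antitone_nat_of_succ_le fun n => ?_
  have hb0 : (0 : ℝ) < b := by exact_mod_cast (by omega : 0 < b)
  have h : (a n : ℝ) + 1 ≤ (b : ℝ) ^ digLen b (a n) := by exact_mod_cast lt_pow_digLen hb (a n)
  rw [Finset.sum_range_succ, add_assoc, concatTerm, ← add_div, Finset.sum_range_succ, pow_add]
  refine add_le_add le_rfl ?_
  rw [div_le_div_iff₀ (by positivity) (by positivity)]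
  nlinarith [pow_pos hb0 (∑ j ∈ Finset.range n, digLen b (a j))]

theorem sum_concatTerm_le {b : ℕ} (hb : 2 ≤ b) (a : ℕ → ℕ) {k n : ℕ} (hkn : k ≤ n) :
    ∑ i ∈ Finset.range n, concatTerm b a i ≤ ∑ i ∈ Finset.range k, concatTerm b a i +
      1 / (b : ℝ) ^ (∑ j ∈ Finset.range k, digLen b (a j)) :=
  (le_add_of_nonneg_right (by positivity)).trans (antitone_sum_concatTerm_add hb a hkn)

theorem summable_concatTerm {b : ℕ} (hb : 2 ≤ b) (a : ℕ → ℕ) : Summable (concatTerm b a) :=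
  summable_of_sum_range_le (concatTerm_nonneg b a) fun n => sum_concatTerm_le hb a n.zero_le

theorem tsum_concatTerm_le {b : ℕ} (hb : 2 ≤ b) (a : ℕ → ℕ) (k : ℕ) :
    ∑' i, concatTerm b a i ≤ ∑ i ∈ Finset.range k, concatTerm b a i +
      1 / (b : ℝ) ^ (∑ j ∈ Finset.range k, digLen b (a j)) :=
  le_of_tendsto (summable_concatTerm hb a).hasSum.tendsto_sum_nat
    ((eventually_ge_atTop k).mono fun _ hn => sum_concatTerm_le hb a hn)

/-- Each digit string starts with a nonzero digit. -/
theorem sum_concatTerm_add_le_tsum {b : ℕ} (hb : 2 ≤ b) {a : ℕ → ℕ} (ha : ∀ i, 0 < a i) (k : ℕ) :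
    ∑ i ∈ Finset.range k, concatTerm b a i +
      1 / (b : ℝ) ^ (∑ j ∈ Finset.range k, digLen b (a j) + 1) ≤ ∑' i, concatTerm b a i := by
  refine le_trans ?_ ((summable_concatTerm hb a).sum_le_tsum (Finset.range (k + 1))
    fun i _ => concatTerm_nonneg b a i)
  have hb0 : (0 : ℝ) < b := by exact_mod_cast (by omega : 0 < b)
  have h : (b : ℝ) ^ digLen b (a k) ≤ b * a k := by exact_mod_cast pow_digLen_le hb (ha k)
  rw [Finset.sum_range_succ, concatTerm, Finset.sum_range_succ, pow_add, pow_add, pow_one]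
  refine add_le_add le_rfl ?_
  rw [div_le_div_iff₀ (by positivity) (by positivity)]
  nlinarith [pow_pos hb0 (∑ j ∈ Finset.range k, digLen b (a j))]

theorem digLen_one {b : ℕ} (hb : 2 ≤ b) : digLen b 1 = 1 := by
  rw [digLen, Nat.digits_of_lt b 1 one_ne_zero (by omega)]
  rfl

/-- Integer form of the base-`2` constraint, with `l` the length of `m`. -/
theorem eq_four_or_eq_two_pow_sub_three {m l : ℕ} (hlow : 2 ^ l ≤ 2 * m) (hup : m < 2 ^ l)
    (h₁ : (4 * 2 ^ l : ℤ) ≤ (2 * (2 ^ l - m) - 1) * (m + 2))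
    (h₂ : ((2 ^ l - m - 1) * (m + 1) : ℤ) ≤ 2 * 2 ^ l) :
    m = 4 ∨ 3 ≤ l ∧ m = 2 ^ l - 3 := by
  obtain hl | hl := lt_or_ge l 4
  · interval_cases l <;> interval_cases m <;> omega
  · have hN : 16 ≤ 2 ^ l := by
      calc 16 = 2 ^ 4 := by norm_num
        _ ≤ 2 ^ l := Nat.pow_le_pow_right (by norm_num) hl
    have hN' : (16 : ℤ) ≤ 2 ^ l := by exact_mod_cast hN
    have hlow' : (2 ^ l : ℤ) ≤ 2 * m := by exact_mod_cast hlow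
    have hup' : (m : ℤ) + 1 ≤ 2 ^ l := by exact_mod_cast hup
    have hle : (2 ^ l : ℤ) - m ≤ 3 := by
      by_contra! hc
      nlinarith [mul_nonneg (by linarith : (0 : ℤ) ≤ 2 ^ l - m - 4)
        (by linarith : (0 : ℤ) ≤ m + 1 - 3)]
    have hge : 3 ≤ (2 ^ l : ℤ) - m := by
      by_contra! hc
      nlinarith [mul_nonneg (by linarith : (0 : ℤ) ≤ 2 - (2 ^ l - m))
        (by linarith : (0 : ℤ) ≤ m + 2)]
    have heq : m + 3 = 2 ^ l := by
      have : (m : ℤ) + 3 = 2 ^ l := by linarith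
      exact_mod_cast this
    exact Or.inr ⟨by omega, by omega⟩

/-- The second partial quotient `a 1` of a Trott number: (i) in base `2`, it is either
`4` or `2ˡ − 3` for some `l ≥ 3`; (ii) in base `3`, it is necessarily `1`. -/
theorem trott_second_quotient_bases_two_three (x : ℝ) (a : ℕ → ℕ) :
    (IsTrottWith 2 x a → a 1 = 4 ∨ ∃ l : ℕ, 3 ≤ l ∧ a 1 = 2 ^ l - 3) ∧
    (IsTrottWith 3 x a → a 1 = 1) := by
  constructor
  · rintro ⟨ha, hcf, hx⟩
    change x = ∑' i, concatTerm 2 a i at hx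
    obtain ⟨z, hz0, hz1, hz⟩ := exists_remainder_of_tendsto_cfVal ha hcf
    have hm : (1 : ℝ) ≤ a 1 := by exact_mod_cast ha 1
    have hy : 0 < 1 / ((a 1 : ℝ) + z) := by positivity
    have hstart := sum_concatTerm_add_le_tsum le_rfl ha 0
    rw [← hx] at hstart
    norm_num at hstart
    have ha0 : a 0 = 1 := by
      by_contra hne
      have h2 : (2 : ℝ) ≤ a 0 := by
        have := ha 0
        exact_mod_cast (by omega : 2 ≤ a 0)
      have : x < 1 / 2 := by
        rw [hz]
        exact one_div_lt_one_div_of_lt (by norm_num) (by linarith)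
      linarith
    have hlow := sum_concatTerm_add_le_tsum le_rfl ha 2
    have hup := tsum_concatTerm_le le_rfl a 2
    rw [← hx] at hlow hup
    simp only [Finset.sum_range_succ, Finset.sum_range_zero, concatTerm, ha0,
      digLen_one le_rfl, zero_add, pow_add, pow_one] at hlow hup
    have hl := pow_digLen_le le_rfl (ha 1)
    have hu := lt_pow_digLen le_rfl (a 1)
    have hcompl : 1 - x = 1 / ((a 1 : ℝ) + z + 1) := by
      rw [hz, ha0]
      field_simp
      push_cast
      ring
    refine (eq_four_or_eq_two_pow_sub_three hl hu ?_ ?_).imp id fun h => ⟨_, h⟩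
    · have h : 1 / ((a 1 : ℝ) + 2) ≤ 1 - x := by
        rw [hcompl]
        exact one_div_le_one_div_of_le (by linarith) (by linarith)
      have h' : 1 / ((a 1 : ℝ) + 2) ≤ (2 * (2 ^ digLen 2 (a 1) - a 1) - 1) /
          (4 * 2 ^ digLen 2 (a 1)) := by
        refine h.trans ((sub_le_sub_left hlow 1).trans_eq ?_)
        field_simp
        push_cast
        ring
      rw [div_le_div_iff₀ (by positivity) (by positivity), one_mul] at h'
      exact_mod_cast h'
    · have h : 1 - x ≤ 1 / ((a 1 : ℝ) + 1) := by
        rw [hcompl]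
        exact one_div_le_one_div_of_le (by linarith) (by linarith)
      have h' : (2 ^ digLen 2 (a 1) - a 1 - 1) / (2 * 2 ^ digLen 2 (a 1)) ≤
          1 / ((a 1 : ℝ) + 1) := by
        refine le_trans (le_of_eq ?_) ((sub_le_sub_left hup 1).trans h)
        field_simp
        push_cast
        ring
      rw [div_le_div_iff₀ (by positivity) (by positivity), one_mul] at h'
      exact_mod_cast h'
  · rintro ⟨ha, hcf, hx⟩
    change x = ∑' i, concatTerm 3 a i at hx
    obtain ⟨z, hz0, hz1, hz⟩ := exists_remainder_of_tendsto_cfVal ha hcf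
    have hm : (1 : ℝ) ≤ a 1 := by exact_mod_cast ha 1
    have hy : 0 < 1 / ((a 1 : ℝ) + z) := by positivity
    have hstart := sum_concatTerm_add_le_tsum (b := 3) (by norm_num) ha 0
    rw [← hx] at hstart
    norm_num at hstart
    have ha0_le : a 0 ≤ 2 := by
      by_contra! hne
      have h3 : (3 : ℝ) ≤ a 0 := by exact_mod_cast hne
      have : x < 1 / 3 := by
        rw [hz]
        exact one_div_lt_one_div_of_lt (by norm_num) (by linarith)
      linarith
    have ha0_ne : a 0 ≠ 2 := by
      intro h2
      have hfirst := (summable_concatTerm (b := 3) (by norm_num) a).sum_le_tsum (Finset.range 1)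
        fun i _ => concatTerm_nonneg 3 a i
      rw [← hx] at hfirst
      norm_num [concatTerm, h2, digLen] at hfirst
      have : x < 1 / 2 := by
        rw [hz, h2]
        exact one_div_lt_one_div_of_lt (by norm_num) (by push_cast; linarith)
      linarith
    have ha0 : a 0 = 1 := by
      have := ha 0
      omega
    have hup := tsum_concatTerm_le (b := 3) (by norm_num) a 1
    rw [← hx] at hup
    norm_num [concatTerm, ha0, digLen] at hup
    by_contra hne
    have h2 : (2 : ℝ) ≤ a 1 := by
      have := ha 1
      exact_mod_cast (by omega : 2 ≤ a 1)
    have hlt : 1 / ((a 1 : ℝ) + z) < 1 / 2 :=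
      one_div_lt_one_div_of_lt (by norm_num) (by linarith)
    have : 1 / (3 / 2) < x := by
      rw [hz, ha0]
      exact one_div_lt_one_div_of_lt (by positivity) (by push_cast; linarith)
    linarith
end
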